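/- Let q be a prime power of characteristic p, let d divide q-1, and let 0 < r ≤ p. The number N of solutions over F_q of the system y_j^d = x + (j-1), j = 1, ..., r, satisfies |N + d^(r-1) - q - 1| ≤ ((rd - r - d - 1)·d^(r-1) + 2)·√q. -/

import Mathlib

open Polynomial

/-- If all coefficients of `P` have degree less than `Q`, then `P` is determined by its value at
`X ^ Q`. -/
theorem Polynomial.eq_zero_of_eval_X_pow_eq_zero {R : Type*} [CommRing R] {Q : ℕ} (P : R[X][X])
    (hP : ∀ j, (P.coeff j).degree < Q) (h : P.eval (X ^ Q) = 0) : P = 0 := by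
  ext j s
  by_cases hs : s < Q
  · have h1 := congrArg (fun f : R[X] => f.coeff (s + Q * j)) h
    simp only [eval_eq_sum_range, finsetSum_coeff, ← pow_mul, coeff_mul_X_pow', coeff_zero] at h1
    rw [Finset.sum_eq_single j] at h1
    · simpa using h1
    · intro b _ hb
      split_ifs with hle
      · apply coeff_eq_zero_of_degree_lt
        refine (hP b).trans_le ?_
        have hlt : b < j := by
          by_contra! hcon
          have : j + 1 ≤ b := by omega
          have := Nat.mul_le_mul_left Q this
          rw [mul_add] at this
          omega
        have := Nat.mul_le_mul_left Q (show b + 1 ≤ j from hlt)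
        rw [mul_add] at this
        exact_mod_cast (by omega : Q ≤ s + Q * j - Q * b)
      · rfl
    · intro hj
      have : P.coeff j = 0 := coeff_eq_zero_of_natDegree_lt (by simpa using hj)
      simp [this]
  · rw [coeff_zero, coeff_zero]
    exact coeff_eq_zero_of_degree_lt ((hP j).trans_le (by exact_mod_cast not_lt.mp hs))

/-- Kummer theory: radicals with pairwise distinct classes are linearly independent. -/
theorem linearIndependent_of_pow_mem_range {F L ι : Type*} [Field F] [Field L] [Algebra F L]
    [IsGalois F L] {d : ℕ} {ζ : F} (hζ : IsPrimitiveRoot ζ d) (hd : 0 < d) (t : ι → L)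
    (ht0 : ∀ i, t i ≠ 0)
    (ht : ∀ i, t i ^ d ∈ Set.range (algebraMap F L))
    (hne : ∀ i k, t i / t k ∈ Set.range (algebraMap F L) → i = k) :
    LinearIndependent F t := by
  have key : ∀ i (σ : L ≃ₐ[F] L), ∃ z : F, algebraMap F L z = σ (t i) / t i := by
    intro i σ
    have h1 : (σ (t i) / t i) ^ d = 1 := by
      obtain ⟨a, ha⟩ := ht i
      rw [div_pow, ← map_pow, ← ha, AlgEquiv.commutes, div_self]
      rw [ha]; exact pow_ne_zero _ (ht0 i)
    have : NeZero d := ⟨hd.ne'⟩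
    have hζ' : IsPrimitiveRoot (algebraMap F L ζ) d :=
      hζ.map_of_injective (algebraMap F L).injective
    obtain ⟨m, _, hm⟩ := hζ'.eq_pow_of_pow_eq_one h1
    exact ⟨ζ ^ m, by rw [map_pow, hm]⟩
  let χ : ι → (L ≃ₐ[F] L) →* L := fun i =>
    { toFun := fun σ => σ (t i) / t i
      map_one' := by simp [ht0 i]
      map_mul' := by
        intro σ τ
        obtain ⟨z, hz⟩ := key i τ
        have : σ (τ (t i) / t i) = τ (t i) / t i := by rw [← hz, AlgEquiv.commutes]
        rw [map_div₀] at this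
        have h0 : σ (t i) ≠ 0 := by simpa using ht0 i
        have h1 := ht0 i
        rw [AlgEquiv.mul_apply, ← this]
        field_simp }
  have hχ : Function.Injective χ := by
    intro i k hik
    apply hne
    rw [InfiniteGalois.mem_range_algebraMap_iff_fixed]
    intro σ
    have h1 : σ (t i) / t i = σ (t k) / t k := DFunLike.congr_fun hik σ
    have h2 : σ (t k) ≠ 0 := by simpa using ht0 k
    have h3 := ht0 i
    have h4 := ht0 k
    rw [map_div₀]
    field_simp at h1 ⊢
    linear_combination h1
  have hli := (linearIndependent_monoidHom (L ≃ₐ[F] L) L).comp χ hχ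
  rw [linearIndependent_iff'] at hli ⊢
  intro s g hg i hi
  have := hli s (fun i => algebraMap F L (g i) * t i) ?_ i hi
  · simpa [ht0 i] using this
  · funext σ
    have h1 := congrArg σ hg
    simp only [map_sum, Algebra.smul_def, map_mul, AlgEquiv.commutes, map_zero] at h1
    simp only [Finset.sum_apply, Pi.smul_apply, Function.comp_apply, smul_eq_mul, Pi.zero_apply]
    rw [← h1]
    refine Finset.sum_congr rfl fun k _ => ?_
    change _ * (σ (t k) / t k) = _
    have := ht0 k
    field_simp

/-- If `∑ φ (h i) * t i = 0` for a nonzero family `t` that multiplies according to `γ`, then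
the matrix of multiplication by `∑ h i * t i` is singular. -/
theorem map_det_eq_zero_of_sum_eq_zero {R S ι : Type*} [CommRing R] [CommRing S] [IsDomain S]
    [Fintype ι] [DecidableEq ι] [AddCommGroup ι] (φ : R →+* S) (γ : ι → ι → R) (t : ι → S)
    (ht : ∀ i k, t i * t k = φ (γ i k) * t (i + k)) (ht0 : t ≠ 0) (h : ι → R)
    (hh : ∑ i, φ (h i) * t i = 0) :
    φ (Matrix.of fun k l => h (l - k) * γ (l - k) k).det = 0 := by
  rw [RingHom.map_det, ← Matrix.exists_mulVec_eq_zero_iff]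
  refine ⟨t, ht0, ?_⟩
  funext k
  rw [Matrix.mulVec, dotProduct, Pi.zero_apply, ← Equiv.sum_comp (Equiv.addRight k)]
  have : ∀ i, φ (h i) * t i * t k = φ (h i) * φ (γ i k) * t (i + k) := fun i => by
    rw [mul_assoc, ht, mul_assoc]
  simp [← this, ← Finset.sum_mul, hh]

theorem eq_zero_of_det_eq_zero {R S ι : Type*} [CommRing R] [IsDomain R] [CommRing S] [IsDomain S]
    [Fintype ι] [DecidableEq ι] [AddCommGroup ι] (φ : R →+* S) (γ : ι → ι → R) (t : ι → S)
    (ht : ∀ i k, t i * t k = φ (γ i k) * t (i + k))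
    (hind : ∀ h : ι → R, ∑ i, φ (h i) * t i = 0 → h = 0) (h : ι → R)
    (hh : (Matrix.of fun k l => h (l - k) * γ (l - k) k).det = 0) : h = 0 := by
  rw [← Matrix.exists_vecMul_eq_zero_iff] at hh
  obtain ⟨u, hu0, hu⟩ := hh
  have h1 : (∑ k, φ (u k) * t k) * (∑ i, φ (h i) * t i) = 0 := by
    have h2 : ∀ k, t k * (∑ i, φ (h i) * t i) = ∑ l, φ (h (l - k) * γ (l - k) k) * t l := by
      intro k
      rw [Finset.mul_sum,
        ← Equiv.sum_comp (Equiv.addRight k) fun l => φ (h (l - k) * γ (l - k) k) * t l]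
      refine Finset.sum_congr rfl fun i _ => ?_
      simp only [Equiv.coe_addRight, add_sub_cancel_right, map_mul]
      linear_combination φ (h i) * ht i k
    rw [Finset.sum_mul]
    simp_rw [mul_assoc, h2, Finset.mul_sum]
    rw [Finset.sum_comm]
    refine Finset.sum_eq_zero fun l _ => ?_
    have h3 := congrArg φ (congrFun hu l)
    simp only [Matrix.vecMul, dotProduct, Matrix.of_apply, Pi.zero_apply, map_zero, map_sum] at h3
    rw [← zero_mul (t l), ← h3, Finset.sum_mul]
    refine Finset.sum_congr rfl fun k _ => ?_
    simp only [map_mul]; ring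
  rcases mul_eq_zero.mp h1 with h2 | h2
  · exact absurd (hind u h2) hu0
  · exact hind h h2

/-- The carry factor in the multiplication of the monomials `∏ τ k ^ i k`, `τ k ^ d = w k`. -/
def kummerCocycle {R κ : Type*} [CommMonoid R] [Fintype κ] {d : ℕ} (w : κ → R) (i k : κ → Fin d) :
    R :=
  ∏ j, w j ^ (((i j : ℕ) + k j) / d)

theorem prod_pow_mul_prod_pow {R S κ : Type*} [CommRing R] [CommRing S] [Fintype κ] {d : ℕ}
    [NeZero d] (φ : R →+* S) (w : κ → R) (τ : κ → S) (hτ : ∀ k, τ k ^ d = φ (w k))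
    (i k : κ → Fin d) :
    (∏ j, τ j ^ (i j : ℕ)) * (∏ j, τ j ^ (k j : ℕ)) =
      φ (kummerCocycle w i k) * ∏ j, τ j ^ ((i + k) j : ℕ) := by
  rw [kummerCocycle, map_prod, ← Finset.prod_mul_distrib, ← Finset.prod_mul_distrib]
  refine Finset.prod_congr rfl fun j _ => ?_
  rw [map_pow, ← hτ, ← pow_mul, ← pow_add, ← pow_add, Pi.add_apply, Fin.val_add, Nat.div_add_mod]

/-- The polynomial `(Z + c) * (X + c) ^ (d - 1)`, where `Z` is the outer variable. -/
noncomputable def kummerRadicand {K : Type*} [Field K] (d : ℕ) (c : K) : K[X][X] :=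
  (X + C (C c)) * C ((X + C c) ^ (d - 1))

theorem rootMultiplicity_kummerRadicand {K : Type*} [Field K] (d : ℕ) (c e : K)
    [Decidable (c = e)] :
    (kummerRadicand d c).rootMultiplicity (-C e) = if c = e then 1 else 0 := by
  have h0 : (X + C c : K[X]) ^ (d - 1) ≠ 0 := pow_ne_zero _ (X_add_C_ne_zero c)
  rw [kummerRadicand, rootMultiplicity_mul (mul_ne_zero (X_add_C_ne_zero _) (C_ne_zero.mpr h0)),
    rootMultiplicity_C, add_zero]
  split_ifs with h
  · subst h
    have := rootMultiplicity_X_sub_C_self (x := (-C c : K[X]))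
    rwa [C_neg, sub_neg_eq_add] at this
  · apply rootMultiplicity_eq_zero
    rw [IsRoot, eval_add, eval_X, eval_C, neg_add_eq_zero, C_inj]
    exact fun h' => h h'.symm

theorem kummerRadicand_ne_zero {K : Type*} [Field K] (d : ℕ) (c : K) : kummerRadicand d c ≠ 0 :=
  mul_ne_zero (X_add_C_ne_zero _) (C_ne_zero.mpr (pow_ne_zero _ (X_add_C_ne_zero c)))

theorem rootMultiplicity_pow_eq_mul {R : Type*} [CommRing R] [IsDomain R] (p : R[X])
    (a : R) (n : ℕ) : (p ^ n).rootMultiplicity a = n * p.rootMultiplicity a := by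
  classical
  rw [← count_roots, roots_pow, Multiset.count_nsmul, count_roots]

theorem rootMultiplicity_prod_pow {R κ : Type*} [CommRing R] [IsDomain R] (s : Finset κ)
    (w : κ → R[X]) (hw : ∀ j, w j ≠ 0) (n : κ → ℕ) (a : R) :
    (∏ j ∈ s, w j ^ n j).rootMultiplicity a = ∑ j ∈ s, n j * (w j).rootMultiplicity a := by
  classical
  rw [← count_roots, roots_prod _ _ (Finset.prod_ne_zero_iff.mpr fun j _ => pow_ne_zero _ (hw j)),
    Multiset.count_bind, Finset.sum_map_val]
  simp

theorem exists_kummer_extension {K κ : Type} [Field K] [Fintype κ] [DecidableEq κ] {d : ℕ}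
    [NeZero d]
    {ζ : K} (hζ : IsPrimitiveRoot ζ d) (c : κ → K) (hc : Function.Injective c) :
    ∃ (L : Type) (_ : Field L) (φ : K[X][X] →+* L) (τ : κ → L),
      (∀ k, τ k ^ d = φ (kummerRadicand d (c k))) ∧
      ∀ h : (κ → Fin d) → K[X][X], ∑ i, φ (h i) * ∏ k, τ k ^ (i k : ℕ) = 0 → h = 0 := by
  classical
  let F := FractionRing K[X][X]
  let L := SeparableClosure F
  have hdK : (d : K) ≠ 0 := (hζ.neZero' ).out
  have hinj : Function.Injective (algebraMap K[X][X] F) := IsFractionRing.injective _ _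
  have hinjL : Function.Injective (algebraMap F L) := (algebraMap F L).injective
  let ψ : K →+* F := (algebraMap K[X][X] F).comp (C.comp C)
  have : NeZero (d : L) := ⟨by
    have : (d : L) = (algebraMap F L) (ψ d) := by simp
    rw [this]
    exact fun h => hdK (ψ.injective (hinjL (by simpa using h)))⟩
  let φ : K[X][X] →+* L := (algebraMap F L).comp (algebraMap K[X][X] F)
  have hφ : Function.Injective φ := hinjL.comp hinj
  choose τ hτ using fun k => IsSepClosed.exists_pow_nat_eq (φ (kummerRadicand d (c k))) d
  have hτ0 : ∀ k, τ k ≠ 0 := fun k h => by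
    have := hτ k
    rw [h, zero_pow (NeZero.ne d)] at this
    exact kummerRadicand_ne_zero d (c k) (hφ (by rw [← this, map_zero]))
  refine ⟨L, inferInstance, φ, τ, hτ, ?_⟩
  have hpow : ∀ i : κ → Fin d, (∏ k, τ k ^ (i k : ℕ)) ^ d =
      φ (∏ k, kummerRadicand d (c k) ^ (i k : ℕ)) := fun i => by
    rw [map_prod, ← Finset.prod_pow]
    refine Finset.prod_congr rfl fun k _ => ?_
    rw [map_pow, ← hτ, pow_right_comm]
  have hli : LinearIndependent F (fun i : κ → Fin d => ∏ k, τ k ^ (i k : ℕ)) := by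
    refine linearIndependent_of_pow_mem_range (hζ.map_of_injective ψ.injective)
      (NeZero.pos d) _ (fun i => Finset.prod_ne_zero_iff.mpr fun k _ => pow_ne_zero _ (hτ0 k))
      (fun i => ⟨_, (hpow i).symm⟩) ?_
    rintro i k ⟨z, hz⟩
    obtain ⟨a, b, hb, rfl⟩ := IsFractionRing.div_surjective (A := K[X][X]) z
    have hb0 : b ≠ 0 := nonZeroDivisors.ne_zero hb
    have hk0 : (∏ j, τ j ^ (k j : ℕ)) ≠ 0 :=
      Finset.prod_ne_zero_iff.mpr fun k _ => pow_ne_zero _ (hτ0 k)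
    have hi0 : (∏ j, τ j ^ (i j : ℕ)) ≠ 0 :=
      Finset.prod_ne_zero_iff.mpr fun k _ => pow_ne_zero _ (hτ0 k)
    have hbL : φ b ≠ 0 := fun h => hb0 (hφ (by rw [h, map_zero]))
    have h1 : φ a * ∏ j, τ j ^ (k j : ℕ) = φ b * ∏ j, τ j ^ (i j : ℕ) := by
      rw [map_div₀] at hz
      change φ a / φ b = _ at hz
      rw [div_eq_div_iff hbL hk0] at hz
      linear_combination hz
    have ha0 : a ≠ 0 := by
      rintro rfl
      rw [map_zero, zero_mul] at h1
      exact mul_ne_zero hbL hi0 h1.symm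
    have h2 := congrArg (· ^ d) h1
    simp only [mul_pow, hpow, ← map_pow, ← map_mul] at h2
    have h3 := hφ h2
    funext j
    have h4 := congrArg (rootMultiplicity (-C (c j))) h3
    have hne : ∀ i : κ → Fin d, ∏ k, kummerRadicand d (c k) ^ (i k : ℕ) ≠ 0 := fun i =>
      Finset.prod_ne_zero_iff.mpr fun k _ => pow_ne_zero _ (kummerRadicand_ne_zero _ _)
    rw [rootMultiplicity_mul (mul_ne_zero (pow_ne_zero _ ha0) (hne k)),
      rootMultiplicity_mul (mul_ne_zero (pow_ne_zero _ hb0) (hne i)),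
      rootMultiplicity_pow_eq_mul, rootMultiplicity_pow_eq_mul,
      rootMultiplicity_prod_pow _ _ (fun _ => kummerRadicand_ne_zero _ _),
      rootMultiplicity_prod_pow _ _ (fun _ => kummerRadicand_ne_zero _ _)] at h4
    simp only [rootMultiplicity_kummerRadicand, hc.eq_iff, mul_ite, mul_one, mul_zero,
      Finset.sum_ite_eq', Finset.mem_univ, if_true] at h4
    have h5 := congrArg (· % d) h4
    simp only [Nat.mul_add_mod, Nat.mod_eq_of_lt (Fin.is_lt _)] at h5
    exact Fin.ext h5.symm
  intro h hh
  rw [Fintype.linearIndependent_iff] at hli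
  funext i
  refine hinj ((hli (fun i => algebraMap _ F (h i)) ?_ i).trans (map_zero _).symm)
  simp only [Algebra.smul_def]
  exact hh

/-- All coefficients of a bivariate polynomial have degree at most `a`. -/
def InnerDegreeLE {R : Type*} [CommRing R] (a : ℕ) (P : R[X][X]) : Prop :=
  ∀ j, (P.coeff j).natDegree ≤ a

namespace InnerDegreeLE

variable {R : Type*} [CommRing R] {a b : ℕ} {P S : R[X][X]}

theorem mono (h : InnerDegreeLE a P) (hab : a ≤ b) : InnerDegreeLE b P :=
  fun j => (h j).trans hab

theorem mul (hP : InnerDegreeLE a P) (hS : InnerDegreeLE b S) : InnerDegreeLE (a + b) (P * S) := by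
  intro j
  rw [coeff_mul]
  exact natDegree_sum_le_of_forall_le _ _ fun x _ =>
    natDegree_mul_le.trans (add_le_add (hP _) (hS _))

theorem sum {ι : Type*} {s : Finset ι} {f : ι → R[X][X]} (h : ∀ i ∈ s, InnerDegreeLE a (f i)) :
    InnerDegreeLE a (∑ i ∈ s, f i) := by
  intro j
  rw [finsetSum_coeff]
  exact natDegree_sum_le_of_forall_le _ _ fun x hx => h x hx j

theorem one : InnerDegreeLE 0 (1 : R[X][X]) := by
  intro j
  rw [coeff_one]
  split_ifs <;> simp

theorem prod {ι : Type*} {s : Finset ι} {f : ι → R[X][X]} (h : ∀ i ∈ s, InnerDegreeLE a (f i)) :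
    InnerDegreeLE (s.card * a) (∏ i ∈ s, f i) := by
  classical
  induction s using Finset.induction_on with
  | empty => simpa using one
  | insert i s hi ih =>
    rw [Finset.prod_insert hi, Finset.card_insert_of_notMem hi, add_mul, one_mul, add_comm]
    exact (h i (by simp)).mul (ih fun k hk => h k (by simp [hk]))

theorem det {ι : Type*} [Fintype ι] [DecidableEq ι] {M : Matrix ι ι R[X][X]}
    (h : ∀ i k, InnerDegreeLE a (M i k)) : InnerDegreeLE (Fintype.card ι * a) M.det := by
  rw [Matrix.det_apply]
  refine sum fun σ _ => ?_
  have h1 := prod (s := Finset.univ) fun i _ => h (σ i) i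
  intro j
  rcases Int.units_eq_one_or (Equiv.Perm.sign σ) with hs | hs <;> rw [hs]
  · simpa using h1 j
  · simpa using h1 j

end InnerDegreeLE

theorem innerDegreeLE_kummerRadicand {K : Type*} [Field K] (d : ℕ) (c : K) :
    InnerDegreeLE (d - 1) (kummerRadicand d c) := by
  intro j
  rw [kummerRadicand, coeff_mul_C, coeff_add, coeff_X, coeff_C]
  refine natDegree_mul_le.trans ?_
  have h1 : ((if 1 = j then 1 else 0) + if j = 0 then C c else 0 : K[X]).natDegree = 0 := by
    split_ifs <;> simp
  rw [h1, zero_add]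
  refine natDegree_pow_le.trans ?_
  simp

theorem innerDegreeLE_kummerCocycle {K κ : Type*} [Field K] [Fintype κ] {d : ℕ} (c : κ → K)
    (i k : κ → Fin d) :
    InnerDegreeLE (Fintype.card κ * (d - 1))
      (kummerCocycle (fun j => kummerRadicand d (c j)) i k) := by
  refine InnerDegreeLE.prod fun j _ => ?_
  have h1 : ((i j : ℕ) + k j) / d ≤ 1 := by
    rw [← Nat.lt_succ_iff, Nat.div_lt_iff_lt_mul (i j).pos]
    omega
  have h2 : ((i j : ℕ) + k j) / d = 0 ∨ ((i j : ℕ) + k j) / d = 1 :=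
    Nat.le_one_iff_eq_zero_or_eq_one.mp h1
  rcases h2 with h2 | h2 <;> rw [h2]
  · rw [pow_zero]; exact InnerDegreeLE.one.mono (Nat.zero_le _)
  · rw [pow_one]; exact innerDegreeLE_kummerRadicand d (c j)

theorem exists_isPrimitiveRoot_of_dvd {K : Type*} [Field K] [Fintype K] {d : ℕ}
    (hd : d ∣ Fintype.card K - 1) : ∃ ζ : K, IsPrimitiveRoot ζ d := by
  classical
  obtain ⟨m, hm⟩ := hd
  obtain ⟨g, hg⟩ := IsCyclic.exists_generator (α := Kˣ)
  have h1 : orderOf g = Fintype.card K - 1 := by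
    rw [orderOf_eq_card_of_forall_mem_zpowers hg, Nat.card_eq_fintype_card, Fintype.card_units]
  have h2 : IsPrimitiveRoot g (Fintype.card K - 1) := h1 ▸ IsPrimitiveRoot.orderOf g
  have hpos : 0 < Fintype.card K - 1 := Nat.sub_pos_of_lt Fintype.one_lt_card
  exact ⟨_, ((h2.map_of_injective (f := Units.coeHom K) Units.val_injective).pow hpos
    (hm.trans (mul_comm _ _)))⟩

/-- The independence statement behind Stepanov's method. -/
theorem eq_zero_of_sum_eval_X_pow_card_eq_zero {K κ : Type} [Field K] [Fintype K] [Fintype κ]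
    [DecidableEq κ] {d : ℕ} [NeZero d] (hd : d ∣ Fintype.card K - 1) (c : κ → K)
    (hc : Function.Injective c) {D : ℕ}
    (hD : d ^ Fintype.card κ * (D + Fintype.card κ * (d - 1)) < Fintype.card K)
    (h : (κ → Fin d) → K[X][X]) (hdeg : ∀ i, InnerDegreeLE D (h i))
    (hh : ∑ i, (h i).eval (X ^ Fintype.card K) *
      ∏ k, ((X + C (c k)) ^ ((Fintype.card K - 1) / d + 1)) ^ (i k : ℕ) = 0) : h = 0 := by
  obtain ⟨ζ, hζ⟩ := exists_isPrimitiveRoot_of_dvd hd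
  obtain ⟨L, _, φ, τ, hτ, hind⟩ := exists_kummer_extension hζ c hc
  set w : κ → K[X][X] := fun j => kummerRadicand d (c j)
  refine eq_zero_of_det_eq_zero φ (kummerCocycle w) _ (prod_pow_mul_prod_pow φ w τ hτ) hind h ?_
  apply eq_zero_of_eval_X_pow_eq_zero (Q := Fintype.card K)
  · intro j
    have h0 : ∀ k l, InnerDegreeLE (D + Fintype.card κ * (d - 1))
        (Matrix.of (fun k l => h (l - k) * kummerCocycle w (l - k) k) k l) := fun k l => by
      rw [Matrix.of_apply]
      exact (hdeg _).mul (innerDegreeLE_kummerCocycle c _ _)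
    have h1 := InnerDegreeLE.det h0 j
    rw [Fintype.card_fun, Fintype.card_fin] at h1
    exact degree_le_natDegree.trans_lt (by exact_mod_cast h1.trans_lt hD)
  · set ev : K[X][X] →+* K[X] := evalRingHom (X ^ Fintype.card K) with hev
    set g : κ → K[X] := fun k => (X + C (c k)) ^ ((Fintype.card K - 1) / d + 1) with hg
    have hgw : ∀ k, g k ^ d = ev (w k) := by
      intro k
      obtain ⟨p, hp⟩ := CharP.exists K
      obtain ⟨n, hpr, hn⟩ := FiniteField.card K p
      have : Fact p.Prime := ⟨hpr⟩
      have h1 : (X + C (c k)) ^ Fintype.card K = X ^ Fintype.card K + C (c k) := by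
        rw [hn, add_pow_char_pow, ← hn, ← C_pow, FiniteField.pow_card]
      have h2 : ev (w k) = (X ^ Fintype.card K + C (c k)) * (X + C (c k)) ^ (d - 1) := by
        simp only [w, hev, coe_evalRingHom, kummerRadicand, eval_mul, eval_C, eval_add, eval_X]
      rw [h2, ← h1, ← pow_add, hg, ← pow_mul]
      congr 1
      rw [add_mul, one_mul, Nat.div_mul_cancel hd]
      have := Fintype.one_lt_card (α := K)
      have := NeZero.pos d
      omega
    have ht0 : (fun i : κ → Fin d => ∏ k, g k ^ (i k : ℕ)) ≠ 0 := fun h0 => by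
      have := congrFun h0 0
      simp at this
    exact map_det_eq_zero_of_sum_eq_zero ev (kummerCocycle w)
      (fun i : κ → Fin d => ∏ k, g k ^ (i k : ℕ))
      (fun i k => prod_pow_mul_prod_pow ev w g hgw i k) ht0 h hh

theorem X_sub_C_pow_dvd_iff_hasseDeriv {R : Type*} [CommRing R] (a : R) (n : ℕ) (f : R[X]) :
    (X - C a) ^ n ∣ f ↔ ∀ l < n, (hasseDeriv l f).eval a = 0 := by
  rw [← map_dvd_iff (taylorEquiv a), map_pow]
  have : taylorEquiv a (X - C a) = X := by
    change taylor a (X - C a) = X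
    rw [map_sub, taylor_X, taylor_C, add_sub_cancel_right]
  rw [this, X_pow_dvd_iff]
  exact forall₂_congr fun l _ => by rw [← taylor_coeff]; rfl

theorem X_sub_C_pow_dvd_hasseDeriv {R : Type*} [CommRing R] {a : R} {m M l : ℕ} (hl : l ≤ M)
    {f : R[X]} (hf : (X - C a) ^ (m + M) ∣ f) : (X - C a) ^ m ∣ hasseDeriv l f := by
  rw [X_sub_C_pow_dvd_iff_hasseDeriv] at hf ⊢
  intro x hx
  have h1 := LinearMap.congr_fun (hasseDeriv_comp (R := R) x l) f
  rw [LinearMap.comp_apply] at h1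
  rw [h1, LinearMap.smul_apply, eval_smul, hf _ (by omega), smul_zero]

theorem exists_linearMap_mul_eq {K V : Type*} [Field K] [AddCommGroup V] [Module K V]
    (A : V →ₗ[K] K[X]) {G : K[X]} (hG : G ≠ 0) (h : ∀ u, G ∣ A u) :
    ∃ H : V →ₗ[K] K[X], ∀ u, A u = G * H u := by
  choose H hH using h
  refine ⟨{ toFun := H, map_add' := fun u v => ?_, map_smul' := fun z u => ?_ }, hH⟩
  · apply mul_left_cancel₀ hG
    rw [← hH, map_add, hH, hH, mul_add]
  · apply mul_left_cancel₀ hG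
    rw [← hH, map_smul, hH, RingHom.id_apply, mul_smul_comm]

theorem finrank_degreeLT {K : Type*} [Field K] (n : ℕ) : Module.finrank K (degreeLT K n) = n := by
  rw [(degreeLTEquiv K n).finrank_eq, Module.finrank_fin_fun]

instance {K : Type*} [Field K] (n : ℕ) : FiniteDimensional K (degreeLT K n) :=
  (degreeLTEquiv K n).symm.finiteDimensional

theorem natDegree_le_of_mem_degreeLT {K : Type*} [Field K] {n : ℕ} {f : K[X]}
    (hf : f ∈ degreeLT K n) : f.natDegree ≤ n :=
  natDegree_le_of_degree_le (mem_degreeLT.mp hf).le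

theorem natDegree_prod_X_add_C_pow {K κ : Type*} [Field K] [Fintype κ] (c : κ → K) (n : κ → ℕ) :
    (∏ k, (X + C (c k)) ^ n k).natDegree = ∑ k, n k := by
  rw [natDegree_prod _ _ fun k _ => pow_ne_zero _ (X_add_C_ne_zero _)]
  simp

/-- Hasse derivatives of `u * ∏ (X + c k) ^ (m k + s k + M)` of order at most `M` are divisible by
`∏ (X + c k) ^ m k`, with a quotient of controlled degree depending linearly on `u`. -/
theorem exists_hasseDeriv_quotient {K κ : Type*} [Field K] [Fintype κ] (c : κ → K)
    (hc : Function.Injective c) (D M l : ℕ) (hl : l ≤ M) (m s : κ → ℕ) :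
    ∃ H : degreeLT K D →ₗ[K] K[X],
      (∀ u : degreeLT K D, hasseDeriv l ((u : K[X]) * ∏ k, (X + C (c k)) ^ (m k + s k + M)) =
        (∏ k, (X + C (c k)) ^ m k) * H u) ∧
      ∀ u : degreeLT K D, (H u).natDegree ≤ D + ∑ k, (s k + M) := by
  have hX : ∀ k, X + C (c k) = X - C (-c k) := fun k => by rw [C_neg, sub_neg_eq_add]
  have hG : ∏ k, (X + C (c k)) ^ m k ≠ 0 :=
    Finset.prod_ne_zero_iff.mpr fun k _ => pow_ne_zero _ (X_add_C_ne_zero _)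
  obtain ⟨H, hH⟩ := exists_linearMap_mul_eq
    ((hasseDeriv l).comp ((LinearMap.mulRight K
      (∏ k, (X + C (c k)) ^ (m k + s k + M))).comp (degreeLT K D).subtype)) hG (fun u => by
      refine Finset.prod_dvd_of_coprime (fun i _ j _ hij => ?_) fun k _ => ?_
      · simp only [Function.onFun, hX]
        exact (pairwise_coprime_X_sub_C (neg_injective.comp hc) hij).pow
      · rw [hX]
        refine X_sub_C_pow_dvd_hasseDeriv hl ?_
        rw [← hX]
        refine ((pow_dvd_pow _ (by omega)).trans
          (Finset.dvd_prod_of_mem (fun k => (X + C (c k)) ^ (m k + s k + M))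
            (Finset.mem_univ k))).trans ?_
        exact dvd_mul_left _ _)
  refine ⟨H, hH, fun u => ?_⟩
  rcases eq_or_ne (H u) 0 with h0 | h0
  · simp [h0]
  have h1 := congrArg natDegree (hH u)
  rw [natDegree_mul hG h0, natDegree_prod_X_add_C_pow] at h1
  have h2 : (hasseDeriv l ((u : K[X]) * ∏ k, (X + C (c k)) ^ (m k + s k + M))).natDegree ≤
      D + ∑ k, (m k + s k + M) := by
    refine (natDegree_hasseDeriv_le _ _).trans ((Nat.sub_le _ _).trans (natDegree_mul_le.trans ?_))
    rw [natDegree_prod_X_add_C_pow]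
    exact add_le_add_left (natDegree_le_of_mem_degreeLT u.2) _
  simp only [LinearMap.comp_apply, LinearMap.mulRight_apply, Submodule.subtype_apply] at h1
  rw [h1] at h2
  simp only [add_assoc, Finset.sum_add_distrib] at h2 ⊢
  omega

theorem X_sub_C_pow_dvd_X_pow_card_pow_sub {K : Type*} [Field K] [Fintype K] (x : K) {M : ℕ}
    (hM : M ≤ Fintype.card K) (j : ℕ) :
    (X - C x) ^ M ∣ (X ^ Fintype.card K) ^ j - C (x ^ j) := by
  obtain ⟨p, hp⟩ := CharP.exists K
  obtain ⟨n, hpr, hn⟩ := FiniteField.card K p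
  have : Fact p.Prime := ⟨hpr⟩
  have h1 : (X - C x) ^ Fintype.card K = X ^ Fintype.card K - C x := by
    rw [hn, sub_pow_char_pow, ← hn, ← C_pow, FiniteField.pow_card]
  rw [C_pow]
  exact ((pow_dvd_pow _ hM).trans h1.dvd).trans (sub_dvd_pow_sub_pow _ _ _)

theorem card_mul_le_natDegree {K : Type*} [Field K] (s : Finset K) (M : ℕ) {f : K[X]} (hf : f ≠ 0)
    (h : ∀ x ∈ s, (X - C x) ^ M ∣ f) : M * s.card ≤ f.natDegree := by
  have h1 : ∏ x ∈ s, (X - C x) ^ M ∣ f :=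
    Finset.prod_dvd_of_coprime (fun i _ j _ hij =>
      (pairwise_coprime_X_sub_C Function.injective_id hij).pow) h
  have h2 := natDegree_le_of_dvd h1 hf
  rw [natDegree_prod _ _ fun k _ => pow_ne_zero _ (X_sub_C_ne_zero _)] at h2
  simpa [mul_comm] using h2

/-- Stepanov's method: an auxiliary polynomial vanishing to high order at all points `x` with
prescribed `(x + c k) ^ ((Q - 1) / d)`. -/
theorem stepanov_card_mul_le {K κ : Type} [Field K] [Fintype K] [DecidableEq K] [Fintype κ]
    [DecidableEq κ] {d : ℕ} [NeZero d] (hd : d ∣ Fintype.card K - 1) (c : κ → K)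
    (hc : Function.Injective c) {D M J : ℕ} (hM : M ≤ Fintype.card K)
    (hD : d ^ Fintype.card κ * (D + Fintype.card κ * (d - 1)) < Fintype.card K)
    (hJ : M * (D + Fintype.card κ * (d + M) + J) < d ^ Fintype.card κ * J * D) (a : κ → K) :
    M * (Finset.univ.filter fun x : K => ∀ k, (x + c k) ^ ((Fintype.card K - 1) / d) = a k).card ≤
      D + Fintype.card κ * (Fintype.card K + d + M) + Fintype.card K * J := by
  set Q := Fintype.card K with hQ
  set e := (Q - 1) / d with he
  have hed : e * d ≤ Q := (Nat.div_mul_le_self _ _).trans (Nat.sub_le _ _)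
  choose H hH hHdeg using fun (l : Fin M) (i : κ → Fin d) =>
    exists_hasseDeriv_quotient c hc D M l l.2.le (fun k => e * i k) (fun k => (i k : ℕ))
  set T : (κ → Fin d) → K[X] := fun i => ∏ k, (X + C (c k)) ^ (e * i k + i k + M) with hT
  let V := (κ → Fin d) × Fin J → degreeLT K D
  let E := D + Fintype.card κ * (d + M) + J
  let A₀ : Fin M → V →ₗ[K] K[X] := fun l =>
    ∑ ij : (κ → Fin d) × Fin J, (LinearMap.mulLeft K
      (C (∏ k, a k ^ (ij.1 k : ℕ)) * X ^ (ij.2 : ℕ))).comp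
      ((H l ij.1).comp (LinearMap.proj ij))
  have hA₀ : ∀ l v, A₀ l v =
      ∑ ij, C (∏ k, a k ^ (ij.1 k : ℕ)) * X ^ (ij.2 : ℕ) * H l ij.1 (v ij) := by
    intro l v
    simp only [A₀, LinearMap.sum_apply]
    rfl
  have hA₀deg : ∀ l v, A₀ l v ∈ degreeLT K E := by
    intro l v
    rw [hA₀]
    refine Submodule.sum_mem _ fun ij _ => ?_
    rw [mem_degreeLT]
    refine degree_le_natDegree.trans_lt ?_
    have h1 : (C (∏ k, a k ^ (ij.1 k : ℕ)) * X ^ (ij.2 : ℕ) * H l ij.1 (v ij)).natDegree ≤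
        ij.2 + (D + ∑ k, ((ij.1 k : ℕ) + M)) :=
      natDegree_mul_le.trans (add_le_add (natDegree_C_mul_X_pow_le _ _) (hHdeg _ _ _))
    have h2 : ∑ k, ((ij.1 k : ℕ) + M) ≤ Fintype.card κ * (d + M) := by
      rw [← smul_eq_mul, ← Finset.card_univ]
      exact Finset.sum_le_card_nsmul _ _ _ fun k _ => by have := (ij.1 k).2; omega
    have h3 := ij.2.2
    exact_mod_cast (show _ < E by omega)
  let A : V →ₗ[K] (Fin M → degreeLT K E) :=
    LinearMap.pi fun l => (A₀ l).codRestrict _ (hA₀deg l)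
  have hker : LinearMap.ker A ≠ ⊥ := by
    apply LinearMap.ker_ne_bot_of_finrank_lt
    rw [Module.finrank_pi_fintype, Module.finrank_pi_fintype]
    simp only [finrank_degreeLT, Finset.sum_const, Finset.card_univ, Fintype.card_prod,
      Fintype.card_fun, Fintype.card_fin, smul_eq_mul]
    exact hJ
  obtain ⟨v, hv, hv0⟩ := Submodule.exists_mem_ne_zero_of_ne_bot hker
  have hv1 : ∀ l, ∑ ij, C (∏ k, a k ^ (ij.1 k : ℕ)) * X ^ (ij.2 : ℕ) * H l ij.1 (v ij) = 0 := by
    intro l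
    rw [← hA₀]
    have := congrFun (LinearMap.mem_ker.mp hv) l
    exact congrArg Subtype.val this
  set R : K[X] := ∑ ij, (v ij : K[X]) * T ij.1 * (X ^ Q) ^ (ij.2 : ℕ) with hR
  have hR0 : R ≠ 0 := by
    intro h0
    let h : (κ → Fin d) → K[X][X] := fun i => ∑ j : Fin J, C (v (i, j) : K[X]) * X ^ (j : ℕ)
    have hcoeff : ∀ i (j : ℕ), (h i).coeff j =
        if hj : j < J then (v (i, ⟨j, hj⟩) : K[X]) else 0 := by
      intro i j
      simp only [h, finsetSum_coeff, coeff_C_mul, coeff_X_pow, mul_ite, mul_one, mul_zero]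
      split_ifs with hj
      · rw [Finset.sum_eq_single ⟨j, hj⟩]
        · simp
        · intro b _ hb
          rw [if_neg]
          rintro rfl
          exact hb rfl
        · simp
      · refine Finset.sum_eq_zero fun b _ => if_neg ?_
        rintro rfl
        exact hj b.2
    have hz := eq_zero_of_sum_eval_X_pow_card_eq_zero hd c hc hD h (fun i j => by
        rw [hcoeff]
        split_ifs
        · exact natDegree_le_of_mem_degreeLT (v _).2
        · simp) (by
        have hF : (∏ k, (X + C (c k)) ^ M : K[X]) ≠ 0 :=
          Finset.prod_ne_zero_iff.mpr fun k _ => pow_ne_zero _ (X_add_C_ne_zero _)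
        apply mul_left_cancel₀ hF
        rw [mul_zero, ← h0, hR, Fintype.sum_prod_type, Finset.mul_sum]
        refine Finset.sum_congr rfl fun i _ => ?_
        simp only [h, eval_finsetSum, eval_mul, eval_C, eval_pow, eval_X, ← hQ, ← he]
        rw [Finset.sum_mul, Finset.mul_sum]
        refine Finset.sum_congr rfl fun j _ => ?_
        have : T i = (∏ k, (X + C (c k)) ^ M) * ∏ k, ((X + C (c k)) ^ (e + 1)) ^ (i k : ℕ) := by
          rw [hT, ← Finset.prod_mul_distrib]
          refine Finset.prod_congr rfl fun k _ => ?_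
          rw [← pow_mul, ← pow_add]
          congr 1
          ring
        rw [this]
        ring)
    apply hv0
    funext ij
    have := hcoeff ij.1 ij.2
    rw [hz] at this
    simp only [Fin.is_lt, dif_pos, Pi.zero_apply, coeff_zero] at this
    exact Subtype.ext this.symm
  refine (card_mul_le_natDegree _ M hR0 ?_).trans ?_
  · intro x hx
    rw [Finset.mem_filter] at hx
    set S : K[X] := ∑ ij, C (x ^ (ij.2 : ℕ)) * ((v ij : K[X]) * T ij.1) with hS
    have h1 : (X - C x) ^ M ∣ R - S := by
      rw [hR, hS, ← Finset.sum_sub_distrib]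
      refine Finset.dvd_sum fun ij _ => ?_
      have := (X_sub_C_pow_dvd_X_pow_card_pow_sub x hM ij.2).mul_left ((v ij : K[X]) * T ij.1)
      convert this using 1
      ring
    have h2 : (X - C x) ^ M ∣ S := by
      rw [X_sub_C_pow_dvd_iff_hasseDeriv]
      intro l hl
      have h3 := congrArg (eval x) (hv1 ⟨l, hl⟩)
      rw [eval_zero, eval_finsetSum] at h3
      rw [hS, map_sum, eval_finsetSum, ← h3]
      refine Finset.sum_congr rfl fun ij _ => ?_
      rw [← smul_eq_C_mul, map_smul, hT]
      have h4 := hH ⟨l, hl⟩ ij.1 (v ij)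
      simp only at h4
      rw [h4, eval_smul, eval_mul, eval_mul, eval_mul, eval_prod, eval_C, eval_pow, eval_X,
        smul_eq_mul]
      simp only [eval_pow, eval_add, eval_X, eval_C, pow_mul, hx.2]
      ring
    have := dvd_add h1 h2
    rwa [sub_add_cancel] at this
  · rw [hR]
    refine natDegree_sum_le_of_forall_le _ _ fun ij _ => ?_
    refine natDegree_mul_le.trans (add_le_add (natDegree_mul_le.trans (add_le_add
      (natDegree_le_of_mem_degreeLT (v ij).2) ?_)) ?_)
    · rw [hT, natDegree_prod_X_add_C_pow, ← smul_eq_mul, ← Finset.card_univ]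
      refine Finset.sum_le_card_nsmul _ _ _ fun k _ => ?_
      have h1 := (ij.1 k).2.le
      have h2 := Nat.mul_le_mul_left e h1
      omega
    · rw [← pow_mul, natDegree_X_pow]
      exact Nat.mul_le_mul_left _ ij.2.2.le

theorem stepanov_param_aux {Q n r d M b g J D : ℕ} (hn : 0 < n) (hM : M = Nat.sqrt Q)
    (hg : g = r * (d - 1) + 1) (hb : b = r + 3) (hJ : J = M / n + b) (hD : D = Q / n - g)
    (hlarge : (r * d + r + 3) + (r + 2) * (n * (g + 1)) < M) :
    n * (D + r * (d - 1)) < Q ∧ M * (D + r * (d + M) + J) < n * J * D := by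
  have hMM : M * M ≤ Q := hM ▸ Nat.sqrt_le Q
  have h1 : n * (Q / n) ≤ Q := Nat.mul_div_le Q n
  have h1' : Q < n * (Q / n) + n := by
    have := Nat.lt_mul_div_succ Q hn
    linarith
  have h2 : M < n * (M / n) + n := by
    have := Nat.lt_mul_div_succ M hn
    linarith
  have h2' : M / n ≤ M := Nat.div_le_self _ _
  have hQ : (r * d + r + 3) * M + (r + 2) * (n * (g + 1)) < Q := by
    generalize r * d + r + 3 = A at hlarge ⊢
    generalize (r + 2) * (n * (g + 1)) = T at hlarge ⊢
    have h3 := Nat.mul_le_mul_left M (Nat.succ_le_of_lt hlarge)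
    have h4 : T ≤ M * T := Nat.le_mul_of_pos_left T (by omega)
    have h5 : M * (A + T).succ = A * M + M * T + M := by rw [Nat.succ_eq_add_one]; ring
    have h6 : 0 < M := by omega
    omega
  have hgn : n * (g + 1) < Q := by
    have := Nat.le_mul_of_pos_left (n * (g + 1)) (show 0 < r + 2 by omega)
    omega
  have hgQ : g ≤ Q / n := by
    by_contra! hcon
    have := Nat.mul_le_mul_left n hcon
    nlinarith
  have hDg : D + g = Q / n := by omega
  have h3 : n * D + n * g = n * (Q / n) := by rw [← mul_add, hDg]
  refine ⟨?_, ?_⟩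
  · have : n * (D + r * (d - 1)) + n = n * D + n * g := by rw [hg]; ring
    omega
  · have h4 : Q < n * D + n * (g + 1) := by rw [mul_add]; omega
    have h5 : M + n * (r + 2) < n * J := by rw [hJ, hb]; nlinarith
    have h6 : (M + n * (r + 2)) * D ≤ n * J * D := Nat.mul_le_mul_right _ h5.le
    have h7 : (r + 2) * Q ≤ (r + 2) * (n * D + n * (g + 1)) := Nat.mul_le_mul_left _ h4.le
    have h8 : M * J ≤ Q + b * M := by rw [hJ]; nlinarith
    rw [hb] at h8
    nlinarith

theorem exists_stepanov_bound (κ : Type) [Fintype κ] [DecidableEq κ] (d : ℕ) [NeZero d] :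
    ∃ B : ℝ, 0 ≤ B ∧ ∀ (K : Type) [Field K] [Fintype K] [DecidableEq K],
      d ∣ Fintype.card K - 1 → ∀ c : κ → K, Function.Injective c → ∀ a : κ → K,
      ((Finset.univ.filter fun x : K =>
        ∀ k, (x + c k) ^ ((Fintype.card K - 1) / d) = a k).card : ℝ) ≤
      Fintype.card K / (d ^ Fintype.card κ : ℕ) + B * √(Fintype.card K) := by
  set r := Fintype.card κ with hr
  set n := d ^ r with hn
  have hn0 : 0 < n := pow_pos (NeZero.pos d) _
  obtain ⟨g, hg⟩ : ∃ g, g = r * (d - 1) + 1 := ⟨_, rfl⟩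
  obtain ⟨b, hb⟩ : ∃ b, b = r + 3 := ⟨_, rfl⟩
  obtain ⟨T, hT⟩ : ∃ T, T = (r * d + r + 3) + (r + 2) * (n * (g + 1)) := ⟨_, rfl⟩
  refine ⟨2 * (1 + 2 * r + r * d + b) + (T + 1), by positivity, ?_⟩
  intro K _ _ _ hd c hc a
  set N := (Finset.univ.filter fun x : K =>
        ∀ k, (x + c k) ^ ((Fintype.card K - 1) / d) = a k).card with hN
  obtain ⟨Q, hQ⟩ : ∃ Q, Q = Fintype.card K := ⟨_, rfl⟩
  have hQ1 : 1 ≤ Q := hQ ▸ Fintype.card_pos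
  obtain ⟨M, hM⟩ : ∃ M, M = Nat.sqrt Q := ⟨_, rfl⟩
  have hMM : M * M ≤ Q := hM ▸ Nat.sqrt_le Q
  have hsq : √(Q : ℝ) < M + 1 := by
    rw [Real.sqrt_lt' (by positivity)]
    have h := Nat.lt_succ_sqrt Q
    rw [← hM] at h
    have h' : (Q : ℝ) < (M + 1) * (M + 1) := by exact_mod_cast h
    nlinarith
  have hs0 : 0 ≤ √(Q : ℝ) := Real.sqrt_nonneg _
  have hss : √(Q : ℝ) * √(Q : ℝ) = Q := Real.mul_self_sqrt (by positivity)
  rw [← hQ]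
  rcases le_or_gt M T with hMT | hMT
  · have h1 : (N : ℝ) ≤ Q := by
      rw [hQ]
      exact_mod_cast Finset.card_le_univ _
    have h2 : (Q : ℝ) ≤ (T + 1) * √Q := by
      have : (M : ℝ) ≤ T := by exact_mod_cast hMT
      nlinarith
    have h3 : (0 : ℝ) ≤ Q / n := by positivity
    have h4 : 0 ≤ 2 * (1 + 2 * (r : ℝ) + r * d + b) * √Q := by positivity
    linarith
  · have hM1 : 1 ≤ M := by omega
    obtain ⟨h1, h2⟩ := stepanov_param_aux hn0 hM hg hb rfl rfl (hT ▸ hMT)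
    have h3 := stepanov_card_mul_le hd c hc (M := M) (J := M / n + b) (D := Q / n - g)
      (hQ ▸ (Nat.le_mul_self M).trans hMM) (hQ ▸ h1) h2 a
    rw [← hN, ← hQ, ← hr] at h3
    have h4 : Q / n - g ≤ Q := (Nat.sub_le _ _).trans (Nat.div_le_self _ _)
    have h5 : M ≤ Q := (Nat.le_mul_self M).trans hMM
    have h6 : r * (Q + d + M) ≤ (2 * r + r * d) * Q := by
      have := Nat.mul_le_mul_left r h5
      have := Nat.mul_le_mul_left (r * d) hQ1
      nlinarith
    have h7 : M * N ≤ (1 + 2 * r + r * d + b) * Q + Q * (M / n) := by nlinarith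
    have h8 : (M : ℝ) * N ≤ (1 + 2 * r + r * d + b) * Q + Q * (M / n) := by
      have : ((M / n : ℕ) : ℝ) ≤ M / n := Nat.cast_div_le
      have h7' : (M : ℝ) * N ≤ (1 + 2 * r + r * d + b) * Q + Q * (M / n : ℕ) := by exact_mod_cast h7
      have : (Q : ℝ) * (M / n : ℕ) ≤ Q * (M / n) := by gcongr
      linarith
    have hM1' : (1 : ℝ) ≤ M := by exact_mod_cast hM1
    have h9 : √(Q : ℝ) ≤ 2 * M := by linarith
    have h10 : (Q : ℝ) ≤ M * (2 * √Q) := by nlinarith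
    have h11 : (M : ℝ) * N ≤ M * (Q / n + 2 * (1 + 2 * r + r * d + b) * √Q) := by
      calc (M : ℝ) * N ≤ (1 + 2 * r + r * d + b) * Q + Q * (M / n) := h8
        _ ≤ (1 + 2 * r + r * d + b) * (M * (2 * √Q)) + Q * (M / n) := by gcongr
        _ = _ := by ring
    have h12 := le_of_mul_le_mul_left h11 (by linarith)
    have h13 : 0 ≤ ((T : ℝ) + 1) * √Q := by positivity
    linarith

theorem card_units_pow_eq {K : Type*} [Field K] [Fintype K] [DecidableEq K] {e : ℕ}
    (he : e ∣ Fintype.card K - 1) (y : Kˣ) :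
    (Finset.univ.filter fun b : Kˣ => y ^ e = b ^ e).card = e := by
  obtain ⟨ζ, hζ⟩ := exists_isPrimitiveRoot_of_dvd he
  have : NeZero e := ⟨by
    rintro rfl
    have := Fintype.one_lt_card (α := K)
    rw [zero_dvd_iff] at he
    omega⟩
  have h1 := hζ.card_rootsOfUnity
  have h2 : (Finset.univ.filter fun b : Kˣ => b ^ e = 1).card = e := by
    refine Eq.trans ?_ h1
    exact (Nat.subtype_card _ (by simp)).symm
  refine Eq.trans ?_ h2
  refine Finset.card_bij' (fun b _ => b / y) (fun b _ => b * y) ?_ ?_ ?_ ?_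
  · intro b hb
    have := (Finset.mem_filter.mp hb).2
    simp [div_pow, this]
  · intro b hb
    have : b ^ e = 1 := by simpa using hb
    simp [mul_pow, this]
  · simp
  · simp

theorem mulChar_eq_of_pow_eq {K : Type*} [Field K] [Fintype K] {d e : ℕ}
    (hde : e * d = Fintype.card K - 1) {ψ : MulChar K ℂ} (hψ : ψ ^ d = 1) {y b : Kˣ}
    (h : y ^ e = b ^ e) : ψ b = ψ y := by
  classical
  obtain ⟨g, hg⟩ := IsCyclic.exists_generator (α := Kˣ)
  have h1 : orderOf g = Fintype.card K - 1 := by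
    rw [orderOf_eq_card_of_forall_mem_zpowers hg, Nat.card_eq_fintype_card, Fintype.card_units]
  have hpos : 0 < Fintype.card K - 1 := Nat.sub_pos_of_lt Fintype.one_lt_card
  obtain ⟨m, hm⟩ := mem_powers_iff_mem_zpowers.mpr (hg (b / y))
  have hm : g ^ m = b / y := hm
  have h2 : g ^ (m * e) = 1 := by rw [pow_mul, hm, div_pow, h, div_self']
  have h3 := orderOf_dvd_of_pow_eq_one h2
  rw [h1, ← hde, mul_comm] at h3
  have he : 0 < e := Nat.pos_of_ne_zero (by rintro rfl; simp at hde; omega)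
  obtain ⟨s, hs⟩ := Nat.dvd_of_mul_dvd_mul_right he h3
  have h4 : b = g ^ m * y := by rw [hm, div_mul_cancel]
  have hd0 : d ≠ 0 := by rintro rfl; simp at hde; omega
  have h5 : ψ ((g ^ m : Kˣ) : K) = 1 := by
    rw [hs, mul_comm, pow_mul, Units.val_pow_eq_pow_val, map_pow, ← MulChar.pow_apply' _ hd0, hψ,
      MulChar.one_apply_coe]
  rw [h4, Units.val_mul, map_mul, h5, one_mul]

theorem exists_norm_sum_prod_mulChar_le (κ : Type) [Fintype κ] (d : ℕ) [NeZero d] :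
    ∃ C : ℝ, 0 ≤ C ∧ ∀ (K : Type) [Field K] [Fintype K], d ∣ Fintype.card K - 1 →
      ∀ c : κ → K, Function.Injective c → ∀ ψ : κ → MulChar K ℂ, (∀ j, ψ j ^ d = 1) →
      (∃ j, ψ j ≠ 1) →
      ‖∑ x, ∏ j, ψ j (x + c j)‖ ≤ C * √(Fintype.card K) := by
  classical
  obtain ⟨B, hB0, hB⟩ := exists_stepanov_bound κ d
  set r := Fintype.card κ with hr
  refine ⟨d ^ r * B + r, by positivity, ?_⟩
  intro K _ _ hd c hc ψ hψ hne
  set Q := Fintype.card K with hQ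
  obtain ⟨e, he⟩ : ∃ e, e = (Q - 1) / d := ⟨_, rfl⟩
  have hed : e * d = Q - 1 := he ▸ Nat.div_mul_cancel hd
  have hQ1 : 1 < Q := Fintype.one_lt_card
  have he0 : 0 < e := Nat.pos_of_ne_zero (by rintro rfl; omega)
  have hsq1 : 1 ≤ √(Q : ℝ) := Real.one_le_sqrt.mpr (by exact_mod_cast hQ1.le)
  let P : K → (κ → Kˣ) → Prop := fun x b => ∀ k, (x + c k) ^ e = (b k : K) ^ e
  let Nb : (κ → Kˣ) → ℕ := fun b => (Finset.univ.filter fun x => P x b).card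
  have hNb : ∀ b, (Nb b : ℝ) ≤ Q / (d ^ r : ℕ) + B * √Q := fun b => by
    have := hB K hd c hc (fun k => (b k : K) ^ e)
    rw [← hQ, ← he] at this
    exact this
  have hunit : ∀ (y : K) (χ : MulChar K ℂ), χ ^ d = 1 →
      ∑ b : Kˣ, (if y ^ e = (b : K) ^ e then χ b else 0) = e * χ y := by
    intro y χ hχ
    by_cases hy : y = 0
    · subst hy
      rw [MulChar.map_zero, mul_zero]
      refine Finset.sum_eq_zero fun b _ => if_neg fun h => ?_
      rw [zero_pow he0.ne'] at h
      exact pow_ne_zero e b.ne_zero h.symm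
    · obtain ⟨u, rfl⟩ := (isUnit_iff_ne_zero.mpr hy)
      have h1 : ∀ b : Kˣ, ((u : K) ^ e = (b : K) ^ e) ↔ u ^ e = b ^ e := fun b => by
        rw [← Units.val_pow_eq_pow_val, ← Units.val_pow_eq_pow_val, Units.val_inj]
      calc ∑ b : Kˣ, (if (u : K) ^ e = (b : K) ^ e then χ b else 0)
          = ∑ b : Kˣ, (if u ^ e = b ^ e then χ u else 0) := by
            refine Finset.sum_congr rfl fun b _ => ?_
            simp only [h1]
            split_ifs with h
            · exact mulChar_eq_of_pow_eq hed hχ h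
            · rfl
        _ = _ := by
            rw [← Finset.sum_filter, Finset.sum_const,
              card_units_pow_eq (hed ▸ Dvd.intro _ rfl) u, nsmul_eq_mul]
  have hmain : ∀ ψ : κ → MulChar K ℂ, (∀ j, ψ j ^ d = 1) →
      ∑ b : κ → Kˣ, (∏ j, ψ j (b j)) * (Nb b : ℂ) = (e : ℂ) ^ r * ∑ x, ∏ j, ψ j (x + c j) := by
    intro ψ hψ
    have h1 : ∀ b : κ → Kˣ, (∏ j, ψ j (b j)) * (Nb b : ℂ) =
        ∑ x, ∏ j, (if (x + c j) ^ e = (b j : K) ^ e then ψ j (b j) else 0) := by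
      intro b
      simp only [Nb]
      rw [Finset.card_eq_sum_ones, Finset.sum_filter]
      push_cast
      rw [Finset.mul_sum]
      refine Finset.sum_congr rfl fun x _ => ?_
      by_cases h : P x b
      · rw [if_pos h, mul_one]
        exact Finset.prod_congr rfl fun j _ => (if_pos (h j)).symm
      · rw [if_neg h, mul_zero]
        obtain ⟨j, hj⟩ := not_forall.mp h
        exact (Finset.prod_eq_zero (Finset.mem_univ j) (if_neg hj)).symm
    simp_rw [h1]
    rw [Finset.sum_comm, Finset.mul_sum]
    refine Finset.sum_congr rfl fun x _ => ?_
    rw [← Fintype.prod_sum (fun j (b : Kˣ) => if (x + c j) ^ e = (b : K) ^ e then ψ j b else 0)]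
    simp_rw [hunit _ _ (hψ _)]
    rw [Finset.prod_mul_distrib, Finset.prod_const, Finset.card_univ]
  have hzero : ∑ b : κ → Kˣ, (∏ j, ψ j (b j)) = 0 := by
    obtain ⟨j, hj⟩ := hne
    rw [← Fintype.prod_sum (fun j (b : Kˣ) => ψ j b)]
    refine Finset.prod_eq_zero (Finset.mem_univ j) ?_
    rw [← MulChar.sum_eq_zero_of_ne_one hj]
    refine Finset.sum_of_injOn (fun u : Kˣ => (u : K)) Units.val_injective.injOn
      (fun _ _ => Finset.mem_univ _) (fun y _ hy => ?_) (fun _ _ => rfl)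
    refine MulChar.map_nonunit _ fun hu => hy ?_
    obtain ⟨u, rfl⟩ := hu
    exact ⟨u, Finset.mem_coe.mpr (Finset.mem_univ u), rfl⟩
  have hcount : (e : ℝ) ^ r * (Q - r) ≤ ∑ b : κ → Kˣ, (Nb b : ℝ) := by
    have h1 := hmain 1 (fun j => one_pow d)
    simp only [Pi.one_apply, MulChar.one_apply_coe, Finset.prod_const_one, one_mul] at h1
    have h2 : ∀ x : K, ∏ j, (1 : MulChar K ℂ) (x + c j) = if ∀ j, x + c j ≠ 0 then 1 else 0 := by
      intro x
      split_ifs with h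
      · exact Finset.prod_eq_one fun j _ => MulChar.one_apply (isUnit_iff_ne_zero.mpr (h j))
      · push Not at h
        obtain ⟨j, hj⟩ := h
        exact Finset.prod_eq_zero (Finset.mem_univ j) (by rw [hj, MulChar.map_zero])
    simp_rw [h2] at h1
    rw [← Finset.sum_filter, Finset.sum_const, nsmul_eq_mul, mul_one] at h1
    have h3 : ∑ b : κ → Kˣ, (Nb b : ℝ) =
      (e : ℝ) ^ r * (Finset.univ.filter fun x : K => ∀ j, x + c j ≠ 0).card := by
      exact_mod_cast h1
    rw [h3]
    have h4 : Q ≤ (Finset.univ.filter fun x : K => ∀ j, x + c j ≠ 0).card + r := by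
      have h5 : (Finset.univ.filter fun x : K => ¬ ∀ j, x + c j ≠ 0).card ≤ r := by
        calc _ ≤ (Finset.univ.image fun j => - c j).card := by
              refine Finset.card_le_card fun x hx => ?_
              simp only [Finset.mem_filter, Finset.mem_univ, true_and, not_forall, not_not] at hx
              obtain ⟨j, hj⟩ := hx
              exact Finset.mem_image.mpr
                ⟨j, Finset.mem_univ _, (eq_neg_of_add_eq_zero_left hj).symm⟩
          _ ≤ _ := Finset.card_image_le
      have h6 := Finset.card_filter_add_card_filter_not (s := (Finset.univ : Finset K))
        (fun x : K => ∀ j, x + c j ≠ 0)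
      rw [Finset.card_univ, ← hQ] at h6
      omega
    have h5 : (Q : ℝ) ≤ (Finset.univ.filter fun x : K => ∀ j, x + c j ≠ 0).card + r := by
      exact_mod_cast h4
    gcongr
    linarith
  obtain ⟨U, hU⟩ : ∃ U : ℝ, U = Q / (d ^ r : ℕ) + B * √Q := ⟨_, rfl⟩
  simp_rw [← hU] at hNb
  have hnorm : ∀ b : κ → Kˣ, ‖∏ j, ψ j (b j)‖ ≤ 1 := fun b => by
    rw [norm_prod]
    refine Finset.prod_le_one (fun _ _ => norm_nonneg _) fun j _ => ?_
    exact le_of_eq (Complex.norm_eq_one_of_pow_eq_one (by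
      rw [← MulChar.pow_apply_coe, hψ, MulChar.one_apply_coe]) (NeZero.ne d))
  have hkey : (e : ℝ) ^ r * ‖∑ x, ∏ j, ψ j (x + c j)‖ ≤ ∑ b : κ → Kˣ, (U - Nb b) := by
    have h1 : (e : ℂ) ^ r * ∑ x, ∏ j, ψ j (x + c j) =
        - ∑ b : κ → Kˣ, (∏ j, ψ j (b j)) * ((U - Nb b : ℝ) : ℂ) := by
      rw [← hmain ψ hψ]
      push_cast
      simp_rw [mul_sub]
      rw [Finset.sum_sub_distrib, ← Finset.sum_mul, hzero]
      ring
    have h2 : (e : ℝ) ^ r * ‖∑ x, ∏ j, ψ j (x + c j)‖ =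
        ‖(e : ℂ) ^ r * ∑ x, ∏ j, ψ j (x + c j)‖ := by simp
    rw [h2, h1, norm_neg]
    refine (norm_sum_le _ _).trans (Finset.sum_le_sum fun b _ => ?_)
    have h3 : 0 ≤ U - Nb b := sub_nonneg.mpr (hNb b)
    rw [norm_mul, Complex.norm_of_nonneg h3]
    exact mul_le_of_le_one_left h3 (hnorm b)
  have hcard : ((Fintype.card (κ → Kˣ) : ℕ) : ℝ) = (e : ℝ) ^ r * (d : ℝ) ^ r := by
    rw [Fintype.card_fun, Fintype.card_units, ← hQ, ← hed, ← mul_pow]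
    push_cast
    rfl
  have hd0 : (0 : ℝ) < (d : ℝ) ^ r := pow_pos (by exact_mod_cast NeZero.pos d) _
  have he0' : (0 : ℝ) < (e : ℝ) ^ r := pow_pos (by exact_mod_cast he0) _
  have h1 : ∑ b : κ → Kˣ, (U - Nb b) ≤ (e : ℝ) ^ r * (d ^ r * U - (Q - r)) := by
    rw [Finset.sum_sub_distrib, Finset.sum_const, Finset.card_univ, nsmul_eq_mul, hcard]
    linarith
  have h2 := le_of_mul_le_mul_left (hkey.trans h1) he0'
  have h3 : (d : ℝ) ^ r * U = Q + d ^ r * B * √Q := by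
    rw [hU]
    push_cast
    field_simp
  rw [h3] at h2
  have h4 : (r : ℝ) ≤ r * √Q := le_mul_of_one_le_right (by positivity) hsq1
  linarith

/-- The characteristic polynomial of `x` over `F`, as a power of its minimal polynomial. -/
noncomputable def normPoly (F : Type*) {K : Type*} [Field F] [Field K] [Algebra F K]
    (x : K) : F[X] :=
  minpoly F x ^ (Module.finrank F K / (minpoly F x).natDegree)

section NormPoly

variable {F K : Type*} [Field F] [Field K] [Algebra F K] [FiniteDimensional F K]

theorem natDegree_minpoly_dvd_finrank (x : K) : (minpoly F x).natDegree ∣ Module.finrank F K := by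
  rw [← IntermediateField.adjoin.finrank (Algebra.IsIntegral.isIntegral x)]
  exact ⟨_, (Module.finrank_mul_finrank F (IntermediateField.adjoin F {x}) K).symm⟩

theorem monic_normPoly (x : K) : (normPoly F x).Monic :=
  (minpoly.monic (Algebra.IsIntegral.isIntegral x)).pow _

theorem natDegree_normPoly (x : K) : (normPoly F x).natDegree = Module.finrank F K := by
  rw [normPoly, natDegree_pow, Nat.div_mul_cancel (natDegree_minpoly_dvd_finrank x)]

theorem eval_normPoly (x : K) (c : F) :
    (normPoly F x).eval c = Algebra.norm F (algebraMap F K c - x) := by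
  have hx : IsIntegral F x := Algebra.IsIntegral.isIntegral x
  set E := IntermediateField.adjoin F {x} with hE
  let pb := IntermediateField.adjoin.powerBasis hx
  have h1 : algebraMap F K c - x = algebraMap E K (algebraMap F E c - pb.gen) := by
    rw [map_sub, ← IsScalarTower.algebraMap_apply, IntermediateField.adjoin.powerBasis_gen,
      IntermediateField.AdjoinSimple.algebraMap_gen]
  have h2 : Module.finrank E K = Module.finrank F K / (minpoly F x).natDegree := by
    rw [← IntermediateField.adjoin.finrank hx]
    exact Nat.eq_div_of_mul_eq_right Module.finrank_pos.ne' (Module.finrank_mul_finrank F E K)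
  have h3 : Algebra.norm F (algebraMap F E c - pb.gen) = (minpoly F x).eval c := by
    have h4 : minpoly F pb.gen = minpoly F x := by
      rw [IntermediateField.adjoin.powerBasis_gen, IntermediateField.minpoly_gen]
    rw [Algebra.norm_eq_matrix_det pb.basis, ← h4, ← charpoly_leftMulMatrix, Matrix.eval_charpoly,
      map_sub, AlgHom.commutes]
    rfl
  rw [h1, ← Algebra.norm_norm (S := E), Algebra.norm_algebraMap, map_pow, h3, h2, normPoly,
    eval_pow]

end NormPoly

theorem card_minpoly_eq {F K : Type*} [Field F] [Finite F] [Field K] [Fintype K] [Algebra F K]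
    {P : F[X]} (hP : Irreducible P) (hm : P.Monic) [DecidablePred fun x : K => minpoly F x = P] :
    (Finset.univ.filter fun x : K => minpoly F x = P).card =
      if P.natDegree ∣ Module.finrank F K then P.natDegree else 0 := by
  classical
  have : FiniteDimensional F K := Module.Finite.of_finite
  split_ifs with h
  · rw [hP.natDegree_dvd_iff_dvd_X_pow_card_pow_sub_X, ← Module.natCard_eq_pow_finrank] at h
    have hK : (X ^ Nat.card K - X : F[X]).map (algebraMap F K) = X ^ Fintype.card K - X := by
      simp [Nat.card_eq_fintype_card]
    have hK0 : (X ^ Fintype.card K - X : K[X]) ≠ 0 :=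
      FiniteField.X_pow_card_sub_X_ne_zero K Fintype.one_lt_card
    have hsplit : (P.map (algebraMap F K)).Splits := by
      refine Splits.of_dvd ?_ hK0 (hK ▸ Polynomial.map_dvd _ h)
      rw [← Nat.card_eq_fintype_card]
      exact splits_X_pow_nat_card_sub_X
    have hsep : P.Separable := PerfectField.separable_of_irreducible hP
    rw [← card_rootSet_eq_natDegree hsep hsplit, ← Set.toFinset_card]
    congr 1
    ext x
    simp only [Finset.mem_filter, Finset.mem_univ, true_and, Set.mem_toFinset, mem_rootSet]
    constructor
    · rintro rfl
      exact ⟨hm.ne_zero, minpoly.aeval _ _⟩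
    · rintro ⟨-, h0⟩
      exact (minpoly.eq_of_irreducible_of_monic hP h0 hm).symm
  · rw [Finset.card_eq_zero, Finset.filter_eq_empty_iff]
    rintro x - rfl
    exact h (natDegree_minpoly_dvd_finrank x)

noncomputable instance (F : Type*) [Field F] [Finite F] (p : ℕ) [Fact p.Prime] [CharP F p] (n : ℕ)
    [NeZero n] : Fintype (FiniteField.Extension F p n) := Fintype.ofFinite _

theorem card_filter_dvd_succ_div_le {D v n : ℕ} (hD : 0 < D) (h : v * D ≤ n) :
    ((Finset.range n).filter fun k => D ∣ k + 1 ∧ (k + 1) / D ≤ v).card = v := by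
  have h1 : (Finset.range v).card = v := Finset.card_range v
  refine Eq.trans (Finset.card_nbij' (t := Finset.range v) (fun k => (k + 1) / D - 1)
    (fun i => (i + 1) * D - 1) ?_ ?_ ?_ ?_) h1
  · intro k hk
    obtain ⟨hk1, ⟨m, hm⟩, hk3⟩ := Finset.mem_filter.mp hk
    simp only [hm, Nat.mul_div_cancel_left m hD] at hk3 ⊢
    have : 0 < m := Nat.pos_of_ne_zero (by rintro rfl; omega)
    exact Finset.mem_range.mpr (by omega)
  · intro i hi
    have hi := Finset.mem_range.mp hi
    have h2 : (i + 1) * D ≤ v * D := Nat.mul_le_mul_right D hi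
    have h3 : 0 < (i + 1) * D := by positivity
    have h4 : (i + 1) * D - 1 + 1 = (i + 1) * D := by omega
    refine Finset.mem_filter.mpr ⟨Finset.mem_range.mpr (show (i + 1) * D - 1 < n by omega), ?_⟩
    simp only [h4, Nat.mul_div_cancel _ hD]
    exact ⟨Dvd.intro_left _ rfl, hi⟩
  · intro k hk
    obtain ⟨hk1, ⟨m, hm⟩, hk3⟩ := Finset.mem_filter.mp hk
    have : 0 < m := Nat.pos_of_ne_zero (by rintro rfl; omega)
    simp only [hm, Nat.mul_div_cancel_left m hD]
    rw [Nat.sub_add_cancel this, mul_comm, ← hm]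
    omega
  · intro i hi
    have h3 : 0 < (i + 1) * D := by positivity
    have h4 : (i + 1) * D - 1 + 1 = (i + 1) * D := by omega
    simp only [h4, Nat.mul_div_cancel _ hD]
    omega

open scoped Classical in
theorem sum_card_normPoly_dvd {F : Type*} [Field F] [Finite F] (p : ℕ) [Fact p.Prime] [CharP F p]
    {f : F[X]} (hf : f.Monic) {n : ℕ} (hn : f.natDegree = n) :
    ∑ k ∈ Finset.range n, (Finset.univ.filter fun x : FiniteField.Extension F p (k + 1) =>
      normPoly F x ∣ f).card = n := by
  have hf0 := hf.ne_zero
  let S := UniqueFactorizationMonoid.normalizedFactors f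
  have hS : ∀ P ∈ S, Irreducible P ∧ P.Monic := fun P hP => by
    have h1 := UniqueFactorizationMonoid.irreducible_of_normalized_factor P hP
    refine ⟨h1, ?_⟩
    rw [← UniqueFactorizationMonoid.normalize_normalized_factor P hP]
    exact monic_normalize h1.ne_zero
  have hdeg : ∑ P ∈ S.toFinset, S.count P * P.natDegree = n := by
    have h1 : S.prod = f := by
      rw [UniqueFactorizationMonoid.prod_normalizedFactors_eq hf0, hf.normalize_eq_self]
    have h2 := congrArg natDegree h1
    rw [natDegree_multiset_prod_of_monic _ fun P hP => (hS P hP).2, hn,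
      Finset.sum_multiset_map_count] at h2
    simpa using h2
  have key : ∀ k, (Finset.univ.filter fun x : FiniteField.Extension F p (k + 1) =>
      normPoly F x ∣ f).card = ∑ P ∈ S.toFinset,
        if P.natDegree ∣ k + 1 ∧ (k + 1) / P.natDegree ≤ S.count P then P.natDegree else 0 := by
    intro k
    have hfin : Module.finrank F (FiniteField.Extension F p (k + 1)) = k + 1 :=
      FiniteField.finrank_extension F p (k + 1)
    rw [Finset.card_eq_sum_card_fiberwise (f := fun x => minpoly F x) (t := S.toFinset)]
    · refine Finset.sum_congr rfl fun P hP => ?_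
      obtain ⟨hP1, hP2⟩ := hS P (Multiset.mem_toFinset.mp hP)
      have hdvd : P ^ ((k + 1) / P.natDegree) ∣ f ↔ (k + 1) / P.natDegree ≤ S.count P := by
        rw [pow_dvd_iff_le_emultiplicity,
          UniqueFactorizationMonoid.emultiplicity_eq_count_normalizedFactors hP1 hf0,
          hP2.normalize_eq_self, Nat.cast_le]
      rw [Finset.filter_filter, ite_and]
      have h1 := card_minpoly_eq (K := FiniteField.Extension F p (k + 1)) hP1 hP2
      rw [hfin] at h1
      by_cases hdv : P ^ ((k + 1) / P.natDegree) ∣ f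
      · rw [if_pos (hdvd.mp hdv), ← h1]
        congr 1
        ext x
        simp only [Finset.mem_filter, Finset.mem_univ, true_and, and_iff_right_iff_imp]
        rintro rfl
        rwa [normPoly, hfin]
      · rw [if_neg fun h => hdv (hdvd.mpr h), ite_self, Finset.card_eq_zero,
          Finset.filter_eq_empty_iff]
        rintro x - ⟨hx, rfl⟩
        rw [normPoly, hfin] at hx
        exact hdv hx
    · intro x hx
      have hx := (Finset.mem_filter.mp hx).2
      have hi : IsIntegral F x := Algebra.IsIntegral.isIntegral x
      refine Finset.mem_coe.mpr (Multiset.mem_toFinset.mpr ?_)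
      rw [UniqueFactorizationMonoid.mem_normalizedFactors_iff' hf0]
      refine ⟨minpoly.irreducible hi, (minpoly.monic hi).normalize_eq_self,
        (dvd_pow_self _ ?_).trans hx⟩
      have h2 := natDegree_minpoly_dvd_finrank (F := F) x
      exact (Nat.div_pos (Nat.le_of_dvd Module.finrank_pos h2) (minpoly.natDegree_pos hi)).ne'
  simp_rw [key]
  rw [Finset.sum_comm, ← hdeg]
  refine Finset.sum_congr rfl fun P hP => ?_
  rw [← Finset.sum_filter, Finset.sum_const, smul_eq_mul, hdeg, card_filter_dvd_succ_div_le]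
  · exact (hS P (Multiset.mem_toFinset.mp hP)).1.natDegree_pos
  · rw [← hdeg]
    exact Finset.single_le_sum (f := fun P => S.count P * P.natDegree) (fun _ _ => Nat.zero_le _) hP

theorem finite_setOf_degree_lt (F : Type*) [Field F] [Finite F] (n : ℕ) :
    {f : F[X] | f.degree < n}.Finite := by
  have : Finite (degreeLT F n) := Finite.of_equiv _ (degreeLTEquiv F n).toEquiv.symm
  refine (Set.toFinite (degreeLT F n : Set F[X])).subset fun f hf => ?_
  exact mem_degreeLT.mpr hf

/-- The polynomials of degree less than `n`. -/
noncomputable def lowDegree (F : Type*) [Field F] [Finite F] (n : ℕ) : Finset F[X] :=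
  (finite_setOf_degree_lt F n).toFinset

theorem mem_lowDegree {F : Type*} [Field F] [Finite F] {n : ℕ} {f : F[X]} :
    f ∈ lowDegree F n ↔ f.degree < n := by
  simp [lowDegree]

theorem finite_setOf_monic_natDegree_eq (F : Type*) [Field F] [Finite F] (n : ℕ) :
    {f : F[X] | f.Monic ∧ f.natDegree = n}.Finite := by
  refine (finite_setOf_degree_lt F (n + 1)).subset fun f hf => ?_
  have := degree_eq_natDegree hf.1.ne_zero
  rw [Set.mem_ofPred, this, hf.2]
  exact_mod_cast Nat.lt_succ_self n

/-- The monic polynomials of degree `n`. -/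
noncomputable def monicOfDegree (F : Type*) [Field F] [Finite F] (n : ℕ) : Finset F[X] :=
  (finite_setOf_monic_natDegree_eq F n).toFinset

theorem mem_monicOfDegree {F : Type*} [Field F] [Finite F] {n : ℕ} {f : F[X]} :
    f ∈ monicOfDegree F n ↔ f.Monic ∧ f.natDegree = n := by
  simp [monicOfDegree]

theorem sum_lowDegree_succ {F : Type*} [Field F] [Fintype F] {φ : F[X] → ℂ}
    (hscale : ∀ (a : Fˣ) (f : F[X]), φ (C (a : F) * f) = φ f) (n : ℕ) :
    ∑ f ∈ lowDegree F (n + 1), φ f =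
      ∑ f ∈ lowDegree F n, φ f + (Fintype.card F - 1) * ∑ f ∈ monicOfDegree F n, φ f := by
  classical
  rw [← Finset.sum_filter_add_sum_filter_not _ fun f => f.degree < (n : WithBot ℕ)]
  congr 1
  · refine Finset.sum_congr ?_ fun _ _ => rfl
    ext f
    rw [Finset.mem_filter, mem_lowDegree, mem_lowDegree, and_iff_right_iff_imp]
    exact fun h => h.trans (by exact_mod_cast Nat.lt_succ_self n)
  · have h1 : ((Fintype.card F : ℂ) - 1) * ∑ f ∈ monicOfDegree F n, φ f =
        ∑ y ∈ (Finset.univ : Finset Fˣ) ×ˢ monicOfDegree F n, φ (C (y.1 : F) * y.2) := by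
      simp_rw [Finset.sum_product, hscale]
      rw [Finset.sum_const, Finset.card_univ, Fintype.card_units, nsmul_eq_mul,
        Nat.cast_sub Fintype.card_pos, Nat.cast_one]
    rw [h1]
    symm
    refine Finset.sum_nbij (g := φ) (fun y : Fˣ × F[X] => C (y.1 : F) * y.2) ?_ ?_ ?_ ?_
    · rintro ⟨a, f⟩ hy
      obtain ⟨hm, hd⟩ := mem_monicOfDegree.mp (Finset.mem_product.mp hy).2
      have h2 : (C (a : F) * f).degree = n := by
        rw [degree_C_mul a.ne_zero, degree_eq_natDegree hm.ne_zero, hd]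
      rw [Finset.mem_filter, mem_lowDegree, h2]
      exact ⟨by exact_mod_cast Nat.lt_succ_self n, lt_irrefl _⟩
    · rintro ⟨a, f⟩ hy ⟨b, g⟩ hz h
      have hf := (mem_monicOfDegree.mp (Finset.mem_product.mp hy).2).1
      have hg := (mem_monicOfDegree.mp (Finset.mem_product.mp hz).2).1
      have hab : a = b := by
        have := congrArg leadingCoeff h
        simp only [leadingCoeff_mul, leadingCoeff_C, hf.leadingCoeff, hg.leadingCoeff,
          mul_one] at this
        exact Units.ext this
      subst hab
      exact Prod.ext rfl (mul_left_cancel₀ (C_ne_zero.mpr a.ne_zero) h)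
    · intro g hg
      rw [Finset.mem_coe, Finset.mem_filter, mem_lowDegree, not_lt] at hg
      have hg0 : g ≠ 0 := by
        rintro rfl
        simp at hg
      have hgd : g.natDegree = n := by
        rw [degree_eq_natDegree hg0] at hg
        have h3 : g.natDegree < n + 1 := by exact_mod_cast hg.1
        have h4 : n ≤ g.natDegree := by exact_mod_cast hg.2
        omega
      have hlc : g.leadingCoeff ≠ 0 := leadingCoeff_ne_zero.mpr hg0
      refine ⟨(Units.mk0 _ hlc, C g.leadingCoeff⁻¹ * g), ?_, ?_⟩
      · refine Finset.mem_coe.mpr (Finset.mem_product.mpr ⟨Finset.mem_univ _, mem_monicOfDegree.mpr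
          ⟨?_, ?_⟩⟩)
        · rw [mul_comm]
          exact monic_mul_leadingCoeff_inv hg0
        · rw [natDegree_C_mul (inv_ne_zero hlc), hgd]
      · simp only [Units.val_mk0]
        rw [← mul_assoc, ← C_mul, mul_inv_cancel₀ hlc, C_1, one_mul]
    · exact fun _ _ => rfl

theorem prod_mulChar_apply_coe {R R' κ : Type*} [CommMonoid R] [CommMonoidWithZero R']
    (s : Finset κ) (χ : κ → MulChar R R') (a : Rˣ) : (∏ j ∈ s, χ j) a = ∏ j ∈ s, χ j a := by
  classical
  induction s using Finset.induction_on with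
  | empty => simp
  | insert j s hj ih => rw [Finset.prod_insert hj, Finset.prod_insert hj, MulChar.mul_apply, ih]

/-- The multiplicative function on polynomials attached to characters `χ j` and points `c j`. -/
noncomputable def charEval {F κ : Type*} [Field F] [Fintype κ] (χ : κ → MulChar F ℂ) (c : κ → F)
    (f : F[X]) : ℂ :=
  ∏ j, χ j (f.eval (c j))

theorem charEval_mul {F κ : Type*} [Field F] [Fintype κ] (χ : κ → MulChar F ℂ) (c : κ → F)
    (f g : F[X]) :
    charEval χ c (f * g) = charEval χ c f * charEval χ c g := by
  simp [charEval, Finset.prod_mul_distrib]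

section LCoeff

variable {F κ : Type*} [Field F] [Fintype F] [Fintype κ]

/-- The coefficients of the `L`-function of `charEval χ c`. -/
noncomputable def lCoeff (χ : κ → MulChar F ℂ) (c : κ → F) (n : ℕ) : ℂ :=
  ∑ f ∈ monicOfDegree F n, charEval χ c f

/-- The character sum over the extension of degree `k` attached to `charEval χ c`. -/
noncomputable def extSum (p : ℕ) [Fact p.Prime] [CharP F p] (χ : κ → MulChar F ℂ) (c : κ → F)
    (k : ℕ) [NeZero k] : ℂ :=
  ∑ x : FiniteField.Extension F p k, charEval χ c (normPoly F x)

theorem lCoeff_zero (χ : κ → MulChar F ℂ) (c : κ → F) : lCoeff χ c 0 = 1 := by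
  have : monicOfDegree F 0 = {1} := by
    ext f
    rw [mem_monicOfDegree, Finset.mem_singleton]
    exact ⟨fun h => eq_one_of_monic_natDegree_zero h.1 h.2, by rintro rfl; simp⟩
  simp [lCoeff, this, charEval]

theorem lCoeff_one (χ : κ → MulChar F ℂ) (c : κ → F) :
    lCoeff χ c 1 = ∑ x, ∏ j, χ j (x + c j) := by
  refine Finset.sum_bij' (fun f _ => f.coeff 0) (fun x _ => X + C x) (fun _ _ => Finset.mem_univ _)
    (fun x _ => mem_monicOfDegree.mpr ⟨monic_X_add_C x, natDegree_X_add_C x⟩) (fun f hf => ?_)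
    (fun x _ => by simp) fun f hf => ?_
  · obtain ⟨h1, h2⟩ := mem_monicOfDegree.mp hf
    exact (h1.eq_X_add_C h2).symm
  · obtain ⟨h1, h2⟩ := mem_monicOfDegree.mp hf
    conv_lhs => rw [h1.eq_X_add_C h2]
    simp [charEval, add_comm]

theorem natCast_mul_lCoeff (p : ℕ) [Fact p.Prime] [CharP F p] (χ : κ → MulChar F ℂ) (c : κ → F)
    (n : ℕ) : n * lCoeff χ c n =
      ∑ k ∈ Finset.range n, extSum p χ c (k + 1) * lCoeff χ c (n - 1 - k) := by
  classical
  have h1 : ∀ f ∈ monicOfDegree F n, (n : ℂ) * charEval χ c f =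
      ∑ k ∈ Finset.range n, ∑ x : FiniteField.Extension F p (k + 1),
        if normPoly F x ∣ f then charEval χ c f else 0 := by
    intro f hf
    obtain ⟨hm, hn⟩ := mem_monicOfDegree.mp hf
    have h2 := congrArg (Nat.cast (R := ℂ)) (sum_card_normPoly_dvd p hm hn)
    rw [← h2, Nat.cast_sum, Finset.sum_mul]
    refine Finset.sum_congr rfl fun k _ => ?_
    rw [← Finset.sum_filter, Finset.sum_const, nsmul_eq_mul]
  rw [lCoeff, Finset.mul_sum, Finset.sum_congr rfl h1, Finset.sum_comm]
  refine Finset.sum_congr rfl fun k hk => ?_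
  rw [Finset.sum_comm, extSum, Finset.sum_mul]
  refine Finset.sum_congr rfl fun x _ => ?_
  have hk := Finset.mem_range.mp hk
  have hx := monic_normPoly (F := F) x
  have hxd : (normPoly F x).natDegree = k + 1 := by
    rw [natDegree_normPoly, FiniteField.finrank_extension]
  rw [← Finset.sum_filter, lCoeff, Finset.mul_sum]
  refine (Finset.sum_nbij (fun h => normPoly F x * h) ?_ ?_ ?_ ?_).symm
  · intro h hh
    obtain ⟨hm, hn⟩ := mem_monicOfDegree.mp hh
    refine Finset.mem_filter.mpr ⟨mem_monicOfDegree.mpr ⟨hx.mul hm, ?_⟩, dvd_mul_right _ _⟩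
    rw [hx.natDegree_mul hm, hxd, hn]
    omega
  · exact (mul_right_injective₀ hx.ne_zero).injOn
  · intro f hf
    obtain ⟨hf, h, rfl⟩ := Finset.mem_filter.mp hf
    obtain ⟨hm, hn⟩ := mem_monicOfDegree.mp hf
    have hm' := hx.of_mul_monic_left hm
    rw [hx.natDegree_mul hm', hxd] at hn
    exact ⟨h, mem_monicOfDegree.mpr ⟨hm', by omega⟩, rfl⟩
  · intro h _
    exact (charEval_mul χ c _ _).symm

theorem sum_charEval_eq_zero [DecidableEq κ] {χ : κ → MulChar F ℂ} {c : κ → F}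
    (hc : Function.Injective c) {j₀ : κ} (hχ : χ j₀ ≠ 1) (S : Finset F[X])
    (hS : ∀ f ∈ S, ∀ g : F[X], g.degree < Fintype.card κ → f + g ∈ S) :
    ∑ f ∈ S, charEval χ c f = 0 := by
  set L : F[X] := ∏ j ∈ Finset.univ.erase j₀, (X - C (c j)) with hL
  have hLdeg : ∀ a : F, (C a * L).degree < Fintype.card κ := by
    intro a
    rcases eq_or_ne a 0 with rfl | ha
    · simp
    · rw [degree_C_mul ha, hL, degree_prod]
      simp only [degree_X_sub_C, Finset.sum_const, nsmul_eq_mul, mul_one]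
      exact_mod_cast Finset.card_lt_card (Finset.erase_ssubset (Finset.mem_univ j₀))
  have hLne : L.eval (c j₀) ≠ 0 := by
    rw [hL, eval_prod, Finset.prod_ne_zero_iff]
    intro j hj
    rw [eval_sub, eval_X, eval_C, sub_ne_zero]
    exact fun h => (Finset.ne_of_mem_erase hj) (hc h).symm
  have hL0 : ∀ j ∈ Finset.univ.erase j₀, L.eval (c j) = 0 := fun j hj => by
    rw [hL, eval_prod, Finset.prod_eq_zero hj]
    simp
  have h1 : ∀ a : F, ∑ f ∈ S, charEval χ c (f + C a * L) = ∑ f ∈ S, charEval χ c f := by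
    intro a
    refine Finset.sum_bij' (fun f _ => f + C a * L) (fun f _ => f + C (-a) * L)
      (fun f hf => hS f hf _ (hLdeg a)) (fun f hf => hS f hf _ (hLdeg (-a))) ?_ ?_ fun _ _ => rfl
    · intro f _
      simp
    · intro f _
      simp
  have h2 : (Fintype.card F : ℂ) * ∑ f ∈ S, charEval χ c f = 0 := by
    rw [← nsmul_eq_mul, ← Finset.card_univ, ← Finset.sum_const,
      ← Finset.sum_congr rfl fun a _ => h1 a,
      Finset.sum_comm]
    refine Finset.sum_eq_zero fun f _ => ?_
    have h3 : ∀ a : F, charEval χ c (f + C a * L) =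
        χ j₀ (f.eval (c j₀) + a * L.eval (c j₀)) *
          ∏ j ∈ Finset.univ.erase j₀, χ j (f.eval (c j)) := by
      intro a
      rw [charEval, ← Finset.mul_prod_erase _ _ (Finset.mem_univ j₀), eval_add, eval_mul, eval_C]
      congr 1
      refine Finset.prod_congr rfl fun j hj => ?_
      rw [eval_add, eval_mul, hL0 j hj, mul_zero, add_zero]
    simp_rw [h3]
    rw [← Finset.sum_mul, ← MulChar.sum_eq_zero_of_ne_one hχ]
    have h4 : Function.Bijective fun a : F => f.eval (c j₀) + a * L.eval (c j₀) := by
      refine Finite.injective_iff_bijective.mp fun a b hab => ?_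
      exact mul_right_cancel₀ hLne (add_left_cancel hab)
    rw [h4.sum_comp (fun y => χ j₀ y), MulChar.sum_eq_zero_of_ne_one hχ, zero_mul]
  exact (mul_eq_zero.mp h2).resolve_left (Nat.cast_ne_zero.mpr Fintype.card_ne_zero)

theorem lCoeff_eq_zero {χ : κ → MulChar F ℂ} {c : κ → F}
    (hc : Function.Injective c) (hχ : ∃ j, χ j ≠ 1) {n : ℕ} (hn : Fintype.card κ ≤ n) :
    lCoeff χ c n = 0 := by
  classical
  obtain ⟨j₀, hj⟩ := hχ
  refine sum_charEval_eq_zero hc hj _ fun f hf g hg => ?_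
  obtain ⟨hm, hd⟩ := mem_monicOfDegree.mp hf
  have h1 : g.degree < f.degree := by
    rw [degree_eq_natDegree hm.ne_zero, hd]
    exact hg.trans_le (by exact_mod_cast hn)
  exact mem_monicOfDegree.mpr ⟨hm.add_of_left h1, by rw [natDegree_add_eq_left_of_degree_lt h1, hd]⟩

theorem sum_lCoeff_eq_zero {χ : κ → MulChar F ℂ} {c : κ → F}
    (hc : Function.Injective c) (hχ : ∃ j, χ j ≠ 1) (hprod : ∏ j, χ j = 1) :
    ∑ n ∈ Finset.range (Fintype.card κ), lCoeff χ c n = 0 := by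
  classical
  have hscale : ∀ (a : Fˣ) (f : F[X]), charEval χ c (C (a : F) * f) = charEval χ c f := by
    intro a f
    have h1 : ∏ j, χ j (a : F) = 1 := by
      rw [← prod_mulChar_apply_coe, hprod, MulChar.one_apply_coe]
    rw [charEval_mul]
    simp [charEval, h1]
  have h0 : ∑ f ∈ lowDegree F 0, charEval χ c f = 0 := by
    obtain ⟨j₀, hj⟩ := hχ
    refine Finset.sum_eq_zero fun f hf => ?_
    have : f = 0 := by simpa [mem_lowDegree] using hf
    exact Finset.prod_eq_zero (Finset.mem_univ j₀) (by simp [this, MulChar.map_zero])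
  have hall : ∀ n, ∑ f ∈ lowDegree F n, charEval χ c f =
      (Fintype.card F - 1) * ∑ i ∈ Finset.range n, lCoeff χ c i := by
    intro n
    induction n with
    | zero => rw [h0, Finset.sum_range_zero, mul_zero]
    | succ n ih =>
      rw [sum_lowDegree_succ hscale, ih, Finset.sum_range_succ, mul_add]
      rfl
  obtain ⟨j₀, hj⟩ := hχ
  have h1 := sum_charEval_eq_zero hc hj (lowDegree F (Fintype.card κ)) fun f hf g hg =>
    mem_lowDegree.mpr ((degree_add_le f g).trans_lt (max_lt (mem_lowDegree.mp hf) hg))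
  rw [hall] at h1
  refine (mul_eq_zero.mp h1).resolve_left ?_
  rw [sub_eq_zero]
  exact_mod_cast (Fintype.one_lt_card (α := F)).ne'

end LCoeff

section RootBound

theorem eval_derivative_eq_mul_tsum {A S : ℕ → ℂ} {m : ℕ} {t : ℂ} (hA : ∀ n, m ≤ n → A n = 0)
    (hrec : ∀ n, ((n + 1 : ℕ) : ℂ) * A (n + 1) = ∑ k ∈ Finset.range (n + 1), S k * A (n - k))
    (hS : Summable fun k => ‖S k * t ^ k‖) :
    (derivative (∑ i ∈ Finset.range m, C (A i) * X ^ i)).eval t =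
      (∑ i ∈ Finset.range m, C (A i) * X ^ i).eval t * ∑' k, S k * t ^ k := by
  have hA0 : ∀ n ∉ Finset.range m, A n * t ^ n = 0 := fun n hn => by
    rw [hA n (by simpa using hn), zero_mul]
  have h1 : (∑ i ∈ Finset.range m, C (A i) * X ^ i).eval t = ∑' n, A n * t ^ n := by
    rw [tsum_eq_sum hA0, eval_finsetSum]
    simp
  have hAs : Summable fun n => ‖A n * t ^ n‖ :=
    summable_of_ne_finset_zero (s := Finset.range m) fun n hn => by rw [hA0 n hn, norm_zero]
  rw [h1, mul_comm, tsum_mul_tsum_eq_tsum_sum_range_of_summable_norm hS hAs]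
  have h2 : ∀ n, ∑ k ∈ Finset.range (n + 1), S k * t ^ k * (A (n - k) * t ^ (n - k)) =
      ((n + 1 : ℕ) : ℂ) * A (n + 1) * t ^ n := by
    intro n
    rw [hrec, Finset.sum_mul]
    refine Finset.sum_congr rfl fun k hk => ?_
    rw [← Nat.add_sub_of_le (Nat.lt_succ_iff.mp (Finset.mem_range.mp hk)), pow_add]
    simp only [Nat.add_sub_cancel_left]
    ring
  simp_rw [h2]
  rw [tsum_eq_sum (s := Finset.range m) fun n hn => by
    rw [hA (n + 1) ((by simpa using hn : m ≤ n).trans (Nat.le_succ n)), mul_zero, zero_mul]]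
  have h3 := Finset.sum_range_succ' (fun i => A i * (i * t ^ (i - 1))) m
  rw [Finset.sum_range_succ, hA m le_rfl] at h3
  simp only [Nat.cast_zero, zero_mul, mul_zero, add_zero, Nat.add_sub_cancel] at h3
  rw [derivative_sum, eval_finsetSum]
  simp only [derivative_C_mul, derivative_X_pow, eval_mul, eval_C, eval_pow, eval_X]
  rw [h3]
  refine Finset.sum_congr rfl fun n _ => ?_
  ring

theorem not_isRoot_of_derivative_eq_mul {L : ℂ[X]} (hL : L ≠ 0) {G : ℂ → ℂ} {ρ B : ℝ}
    (hG : ∀ t, ‖t‖ < ρ → ‖G t‖ ≤ B)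
    (h : ∀ t, ‖t‖ < ρ → (derivative L).eval t = L.eval t * G t) {β : ℂ} (hβ : ‖β‖ < ρ) :
    ¬ L.IsRoot β := by
  intro hroot
  obtain ⟨H, hH, hHβ⟩ := exists_eq_pow_rootMultiplicity_mul_and_not_dvd L hL β
  set e := L.rootMultiplicity β with he
  have he0 : 0 < e := (rootMultiplicity_pos hL).mpr hroot
  obtain ⟨s, hs⟩ := Nat.exists_eq_succ_of_ne_zero he0.ne'
  rw [dvd_iff_isRoot, IsRoot.def] at hHβ
  have h1 : ∀ᶠ t in nhdsWithin β {β}ᶜ, ((e : ℂ) * H.eval t + (t - β) * (derivative H).eval t) =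
      (t - β) * H.eval t * G t := by
    have hball : ∀ᶠ t in nhdsWithin β {β}ᶜ, ‖t‖ < ρ :=
      (continuous_norm.continuousAt.eventually_lt continuousAt_const hβ).filter_mono
        nhdsWithin_le_nhds
    filter_upwards [hball, self_mem_nhdsWithin] with t ht htne
    have h2 := h t ht
    have h3 : t - β ≠ 0 := sub_ne_zero.mpr htne
    rw [hH, hs] at h2
    simp only [derivative_mul, derivative_X_sub_C_pow, eval_add, eval_mul, eval_pow, eval_sub,
      eval_X, eval_C, Nat.succ_sub_one] at h2
    rw [hs]
    refine mul_left_cancel₀ (pow_ne_zero s h3) ?_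
    rw [Nat.succ_eq_add_one, pow_succ] at h2
    linear_combination h2
  have hne : (nhdsWithin β {β}ᶜ).NeBot := inferInstance
  have hsub : Filter.Tendsto (fun t : ℂ => t - β) (nhdsWithin β {β}ᶜ) (nhds 0) := by
    have : ContinuousAt (fun t : ℂ => t - β) β := by fun_prop
    have h2 := this.tendsto
    rw [sub_self] at h2
    exact h2.mono_left nhdsWithin_le_nhds
  have hHt : Filter.Tendsto (fun t => H.eval t) (nhdsWithin β {β}ᶜ) (nhds (H.eval β)) :=
    H.continuous.continuousAt.tendsto.mono_left nhdsWithin_le_nhds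
  have hHdt : Filter.Tendsto (fun t => (derivative H).eval t) (nhdsWithin β {β}ᶜ)
      (nhds ((derivative H).eval β)) :=
    (derivative H).continuous.continuousAt.tendsto.mono_left nhdsWithin_le_nhds
  have hl := (hHt.const_mul (e : ℂ)).add (hsub.mul hHdt)
  have hr : Filter.Tendsto (fun t => (t - β) * H.eval t * G t) (nhdsWithin β {β}ᶜ) (nhds 0) := by
    have h2 := hsub.mul hHt
    rw [zero_mul] at h2
    refine h2.zero_mul_isBoundedUnder_le ⟨B, ?_⟩
    rw [Filter.eventually_map]
    exact ((continuous_norm.continuousAt.eventually_lt continuousAt_const hβ).filter_mono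
      nhdsWithin_le_nhds).mono hG
  have h4 := tendsto_nhds_unique (hl.congr' h1) hr
  rw [zero_mul, add_zero] at h4
  rcases mul_eq_zero.mp h4 with h5 | h5
  · exact he0.ne' (by exact_mod_cast h5)
  · exact hHβ h5

theorem norm_le_of_isRoot_of_norm_powerSum_le {A S : ℕ → ℂ} {m : ℕ} {R B : ℝ} (hR : 0 < R)
    (hm : 0 < m) (hA0 : A 0 = 1) (hA : ∀ n, m ≤ n → A n = 0)
    (hrec : ∀ n, ((n + 1 : ℕ) : ℂ) * A (n + 1) = ∑ k ∈ Finset.range (n + 1), S k * A (n - k))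
    (hS : ∀ k, ‖S k‖ ≤ B * R ^ (k + 1)) {α : ℂ}
    (hα : (∑ i ∈ Finset.range m, C (A i) * X ^ (m - 1 - i)).IsRoot α) : ‖α‖ ≤ R := by
  by_contra! hlt
  have hα0 : 0 < ‖α‖ := hR.trans hlt
  have hαne : α ≠ 0 := norm_pos_iff.mp hα0
  set L : ℂ[X] := ∑ i ∈ Finset.range m, C (A i) * X ^ i with hLdef
  have hLroot : L.IsRoot α⁻¹ := by
    have h1 : α ^ (m - 1) * L.eval α⁻¹ = 0 := by
      rw [← hα.eq_zero, hLdef, eval_finsetSum, eval_finsetSum, Finset.mul_sum]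
      refine Finset.sum_congr rfl fun i hi => ?_
      have hi := Finset.mem_range.mp hi
      have h2 : m - 1 = (m - 1 - i) + i := by omega
      simp only [eval_mul, eval_C, eval_pow, eval_X]
      conv_lhs => rw [h2, pow_add]
      have h3 : α ^ i * α⁻¹ ^ i = 1 := by rw [← mul_pow, mul_inv_cancel₀ hαne, one_pow]
      linear_combination (A i * α ^ (m - 1 - i)) * h3
    exact (mul_eq_zero.mp h1).resolve_left (pow_ne_zero _ hαne)
  have hL0 : L ≠ 0 := by
    intro h
    have h1 := congrArg (fun f => eval 0 f) h
    obtain ⟨m, rfl⟩ := Nat.exists_eq_succ_of_ne_zero hm.ne'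
    simp [hLdef, Finset.sum_range_succ', hA0, eval_finsetSum] at h1
  obtain ⟨ρ, hρ1, hρ2⟩ : ∃ ρ, ‖α‖⁻¹ < ρ ∧ ρ < R⁻¹ := exists_between (inv_strictAnti₀ hR hlt)
  have hρ0 : 0 < ρ := (inv_pos.mpr hα0).trans hρ1
  have hρR : R * ρ < 1 := by
    calc R * ρ < R * R⁻¹ := by gcongr
      _ = 1 := mul_inv_cancel₀ hR.ne'
  have hB : 0 ≤ B := by
    have := (norm_nonneg _).trans (hS 0)
    rw [zero_add, pow_one] at this
    exact nonneg_of_mul_nonneg_left this hR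
  have hgeo : Summable fun k : ℕ => B * R * (R * ρ) ^ k :=
    (summable_geometric_of_lt_one (by positivity) hρR).mul_left _
  have hbound : ∀ t : ℂ, ‖t‖ < ρ → ∀ k, ‖S k * t ^ k‖ ≤ B * R * (R * ρ) ^ k := by
    intro t ht k
    rw [norm_mul, norm_pow]
    calc ‖S k‖ * ‖t‖ ^ k ≤ (B * R ^ (k + 1)) * ρ ^ k := by
          gcongr
          exact hS k
      _ = _ := by ring
  have hsum : ∀ t : ℂ, ‖t‖ < ρ → Summable fun k => ‖S k * t ^ k‖ := fun t ht =>
    hgeo.of_nonneg_of_le (fun _ => norm_nonneg _) (hbound t ht)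
  refine not_isRoot_of_derivative_eq_mul hL0 (G := fun t => ∑' k, S k * t ^ k) (ρ := ρ)
    (B := ∑' k, B * R * (R * ρ) ^ k) (fun t ht => ?_)
    (fun t ht => eval_derivative_eq_mul_tsum hA hrec (hsum t ht)) (by rwa [norm_inv]) hLroot
  exact (norm_tsum_le_tsum_norm (hsum t ht)).trans ((hsum t ht).tsum_le_tsum (hbound t ht) hgeo)

theorem norm_multiset_sum_le_card_mul {s : Multiset ℂ} {R : ℝ} (h : ∀ z ∈ s, ‖z‖ ≤ R) :
    ‖s.sum‖ ≤ Multiset.card s * R := by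
  refine (norm_multiset_sum_le s).trans ?_
  have := Multiset.sum_le_card_nsmul (s.map norm) R (by simpa using h)
  simpa using this

theorem norm_coeff_one_le {A S : ℕ → ℂ} {m : ℕ} {R B : ℝ} (hR : 0 < R)
    (hm : 0 < m) (hA0 : A 0 = 1) (hA : ∀ n, m ≤ n → A n = 0)
    (hrec : ∀ n, ((n + 1 : ℕ) : ℂ) * A (n + 1) = ∑ k ∈ Finset.range (n + 1), S k * A (n - k))
    (hS : ∀ k, ‖S k‖ ≤ B * R ^ (k + 1)) :
    ‖A 1‖ ≤ ((m : ℝ) - 1) * R ∧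
      (∑ i ∈ Finset.range m, A i = 0 → ‖A 1 + 1‖ ≤ ((m : ℝ) - 2) * R) := by
  set P : ℂ[X] := ∑ i ∈ Finset.range m, C (A i) * X ^ (m - 1 - i) with hP
  have hroots : ∀ z ∈ P.roots, ‖z‖ ≤ R := fun z hz =>
    norm_le_of_isRoot_of_norm_powerSum_le hR hm hA0 hA hrec hS (isRoot_of_mem_roots hz)
  have hcoeff : ∀ i < m, P.coeff (m - 1 - i) = A i := by
    intro i hi
    rw [hP, finsetSum_coeff, Finset.sum_eq_single_of_mem i (Finset.mem_range.mpr hi)]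
    · simp
    · intro j hj hji
      have hj := Finset.mem_range.mp hj
      rw [coeff_C_mul, coeff_X_pow, if_neg (by omega), mul_zero]
  have hdeg : P.natDegree ≤ m - 1 := by
    refine natDegree_sum_le_of_forall_le _ _ fun i _ => ?_
    exact (natDegree_C_mul_X_pow_le _ _).trans (Nat.sub_le _ _)
  have hc0 : P.coeff (m - 1) = 1 := by simpa [hA0] using hcoeff 0 hm
  have hmonic : P.Monic := monic_of_natDegree_le_of_coeff_eq_one _ hdeg hc0
  have hdeg' : P.natDegree = m - 1 :=
    le_antisymm hdeg (le_natDegree_of_ne_zero (by rw [hc0]; exact one_ne_zero))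
  have hsplit : P.Splits := IsAlgClosed.splits P
  have hcard : Multiset.card P.roots = m - 1 := by rw [← hsplit.natDegree_eq_card_roots, hdeg']
  have hA1 : A 1 = - P.roots.sum := by
    rw [← hsplit.nextCoeff_eq_neg_sum_roots_of_monic hmonic, nextCoeff, hdeg']
    split_ifs with h
    · exact hA 1 (by omega)
    · exact (hcoeff 1 (by omega)).symm
  refine ⟨?_, fun hsum => ?_⟩
  · rw [hA1, norm_neg]
    have := norm_multiset_sum_le_card_mul hroots
    rwa [hcard, Nat.cast_sub hm, Nat.cast_one] at this
  · have h1 : (1 : ℂ) ∈ P.roots := by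
      rw [mem_roots hmonic.ne_zero, IsRoot.def, hP, eval_finsetSum]
      simpa using hsum
    obtain ⟨s, hs⟩ := Multiset.exists_cons_of_mem h1
    rw [hs, Multiset.card_cons] at hcard
    have h2 : Multiset.card s = (m : ℝ) - 2 := by
      have : Multiset.card s + 2 = m := by omega
      rw [← this]
      push_cast
      ring
    rw [hA1, hs, Multiset.sum_cons, neg_add, neg_add_cancel_comm, norm_neg, ← h2]
    exact norm_multiset_sum_le_card_mul fun z hz => hroots z (hs ▸ Multiset.mem_cons_of_mem hz)

end RootBound

/-- The multiplicative character of a finite extension obtained by composing with the norm. -/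
noncomputable def normMulChar {F R' : Type*} (K : Type*) [Field F] [Field K] [Algebra F K]
    [FiniteDimensional F K] [CommMonoidWithZero R'] (χ : MulChar F R') : MulChar K R' where
  toMonoidHom := χ.toMonoidHom.comp (Algebra.norm F)
  map_nonunit' x hx := by
    have h : x = 0 := by simpa using hx
    simp [h, MulChar.map_zero]

theorem normMulChar_apply {F K R' : Type*} [Field F] [Field K] [Algebra F K]
    [FiniteDimensional F K] [CommMonoidWithZero R'] (χ : MulChar F R') (x : K) :
    normMulChar K χ x = χ (Algebra.norm F x) := rfl

theorem normMulChar_pow_eq_one {F K R' : Type*} [Field F] [Field K] [Algebra F K]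
    [FiniteDimensional F K] [CommMonoidWithZero R'] {χ : MulChar F R'} {d : ℕ} (h : χ ^ d = 1) :
    normMulChar K χ ^ d = 1 := by
  ext u
  have h1 : Algebra.norm F (u : K) ≠ 0 := Algebra.norm_ne_zero_iff.mpr u.ne_zero
  rw [MulChar.pow_apply_coe, normMulChar_apply, MulChar.one_apply_coe]
  have h2 := MulChar.pow_apply_coe χ d (Units.mk0 _ h1)
  rw [h, MulChar.one_apply_coe] at h2
  exact h2.symm

theorem normMulChar_ne_one {F K R' : Type*} [Field F] [Field K] [Finite K] [Algebra F K]
    [FiniteDimensional F K] [CommMonoidWithZero R'] {χ : MulChar F R'} (h : χ ≠ 1) :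
    normMulChar K χ ≠ 1 := by
  intro h1
  refine h (MulChar.ext fun u => ?_)
  obtain ⟨x, hx⟩ := FiniteField.norm_surjective F K (u : F)
  have hx0 : IsUnit x := isUnit_iff_ne_zero.mpr (by
    rintro rfl
    rw [Algebra.norm_zero] at hx
    exact u.ne_zero hx.symm)
  rw [MulChar.one_apply_coe, ← hx, ← normMulChar_apply, h1, MulChar.one_apply hx0]

theorem extSum_eq_sum_prod_normMulChar {F κ : Type*} [Field F] [Fintype F] [Fintype κ] (p : ℕ)
    [Fact p.Prime] [CharP F p] (χ : κ → MulChar F ℂ) (c : κ → F) (k : ℕ) [NeZero k] :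
    extSum p χ c k = ∑ x : FiniteField.Extension F p k,
      ∏ j, normMulChar (FiniteField.Extension F p k) (χ j) (x + algebraMap F _ (c j)) := by
  rw [extSum, ← Equiv.sum_comp (Equiv.neg (FiniteField.Extension F p k))]
  refine Finset.sum_congr rfl fun x _ => Finset.prod_congr rfl fun j _ => ?_
  rw [eval_normPoly, normMulChar_apply, Equiv.neg_apply, sub_neg_eq_add, add_comm]

/-- The Weil bound for a product of multiplicative characters evaluated at distinct linear
polynomials. -/
theorem norm_sum_prod_mulChar_le {F : Type*} {κ : Type} [Field F] [Fintype F] [Fintype κ] {d : ℕ}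
    (hd : d ∣ Fintype.card F - 1) {c : κ → F} (hc : Function.Injective c)
    {χ : κ → MulChar F ℂ} (hχ : ∀ j, χ j ^ d = 1) (hne : ∃ j, χ j ≠ 1) :
    ‖∑ x, ∏ j, χ j (x + c j)‖ ≤ ((Fintype.card κ : ℝ) - 1) * √(Fintype.card F) ∧
      (∏ j, χ j = 1 →
        ‖∑ x, ∏ j, χ j (x + c j) + 1‖ ≤ ((Fintype.card κ : ℝ) - 2) * √(Fintype.card F)) := by
  obtain ⟨p, hp⟩ := CharP.exists F
  have : Fact p.Prime := ⟨CharP.char_is_prime F p⟩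
  have hq1 : 1 < Fintype.card F := Fintype.one_lt_card
  have : NeZero d := ⟨by
    rintro rfl
    rw [zero_dvd_iff] at hd
    omega⟩
  obtain ⟨B, -, hB⟩ := exists_norm_sum_prod_mulChar_le κ d
  have hsum : lCoeff χ c 1 = ∑ x, ∏ j, χ j (x + c j) := lCoeff_one χ c
  have hA : ∀ n, Fintype.card κ ≤ n → lCoeff χ c n = 0 := fun n hn => lCoeff_eq_zero hc hne hn
  have hκ : 0 < Fintype.card κ := Fintype.card_pos_iff.mpr (hne.nonempty)
  have hS : ∀ k, ‖extSum p χ c (k + 1)‖ ≤ B * √(Fintype.card F) ^ (k + 1) := by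
    intro k
    have hcard : Fintype.card (FiniteField.Extension F p (k + 1)) = Fintype.card F ^ (k + 1) := by
      rw [Fintype.card_eq_nat_card, FiniteField.natCard_extension, Nat.card_eq_fintype_card]
    rw [extSum_eq_sum_prod_normMulChar]
    have h1 := hB (FiniteField.Extension F p (k + 1))
      (hcard ▸ hd.trans (by simpa using Nat.sub_dvd_pow_sub_pow (Fintype.card F) 1 (k + 1)))
      (fun j => algebraMap F _ (c j)) ((algebraMap F _).injective.comp hc)
      (fun j => normMulChar _ (χ j)) (fun j => normMulChar_pow_eq_one (hχ j))
      (hne.imp fun j hj => normMulChar_ne_one hj)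
    refine h1.trans_eq ?_
    congr 1
    rw [hcard, Nat.cast_pow, Real.sqrt_eq_iff_mul_self_eq (by positivity) (by positivity),
      ← mul_pow,
      Real.mul_self_sqrt (by positivity)]
  have hmain := norm_coeff_one_le (A := lCoeff χ c) (S := fun k => extSum p χ c (k + 1))
    (Real.sqrt_pos.mpr (by exact_mod_cast hq1.le : (0 : ℝ) < Fintype.card F)) hκ (lCoeff_zero χ c)
    hA
    (fun n => by simpa using natCast_mul_lCoeff p χ c (n + 1)) hS
  rw [hsum] at hmain
  exact ⟨hmain.1, fun hprod => hmain.2 (sum_lCoeff_eq_zero hc hne hprod)⟩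

/-- A character `χ ^ i`, with the trivial character extended by `1` at `0`. -/
noncomputable def extPow {F : Type*} [Field F] {d : ℕ} (ω : MulChar F ℂ) (i : ZMod d) (u : F) : ℂ :=
  if i = 0 then 1 else (ω ^ i.val) u

theorem eq_pow_of_apply_eq_one {F : Type*} [Field F] [Finite F] {ω : MulChar F ℂ} {u : Fˣ}
    (h : ω u = 1) : ∃ v : Fˣ, v ^ orderOf ω = u := by
  obtain ⟨g, hg⟩ := IsCyclic.exists_generator (α := Fˣ)
  obtain ⟨m, hm : g ^ m = u⟩ := mem_powers_iff_mem_zpowers.mpr (hg u)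
  have h1 : ω ^ m = 1 := by
    ext x
    obtain ⟨n, hn : g ^ n = x⟩ := mem_powers_iff_mem_zpowers.mpr (hg x)
    rw [MulChar.pow_apply_coe, MulChar.one_apply_coe, ← hn, Units.val_pow_eq_pow_val, map_pow,
      ← pow_mul, mul_comm, pow_mul, ← map_pow, ← Units.val_pow_eq_pow_val, hm, h, one_pow]
  obtain ⟨s, hs⟩ := orderOf_dvd_of_pow_eq_one h1
  exact ⟨g ^ s, by rw [← pow_mul, mul_comm, ← hs, hm]⟩

theorem ZMod.sum_val_eq_sum_range {d : ℕ} [NeZero d] {M : Type*} [AddCommMonoid M] (f : ℕ → M) :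
    ∑ i : ZMod d, f i.val = ∑ i ∈ Finset.range d, f i := by
  obtain ⟨n, rfl⟩ := Nat.exists_eq_succ_of_ne_zero (NeZero.ne d)
  exact Fin.sum_univ_eq_sum_range f (n + 1)

theorem card_pow_eq_sum_extPow {F : Type*} [Field F] [Fintype F] [DecidableEq F] {d : ℕ} [NeZero d]
    (hd : d ∣ Fintype.card F - 1) {ω : MulChar F ℂ} (hω : orderOf ω = d) (u : F) :
    (Fintype.card {y : F // y ^ d = u} : ℂ) = ∑ i : ZMod d, extPow ω i u := by
  have hd0 : d ≠ 0 := NeZero.ne d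
  rcases eq_or_ne u 0 with rfl | hu
  · rw [Finset.sum_eq_single_of_mem 0 (Finset.mem_univ _) fun i _ hi => by
      rw [extPow, if_neg hi, MulChar.map_zero]]
    rw [extPow, if_pos rfl]
    simp [pow_eq_zero_iff hd0]
  · obtain ⟨u, rfl⟩ := isUnit_iff_ne_zero.mpr hu
    have h1 : ∀ i : ZMod d, extPow ω i (u : F) = ω u ^ i.val := by
      intro i
      rw [extPow]
      split_ifs with h
      · rw [h, ZMod.val_zero, pow_zero]
      · rw [MulChar.pow_apply_coe]
    simp_rw [h1]
    rw [ZMod.sum_val_eq_sum_range]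
    have hωd : ω ^ d = 1 := hω ▸ pow_orderOf_eq_one ω
    by_cases h2 : ω u = 1
    · obtain ⟨v, hv⟩ := eq_pow_of_apply_eq_one h2
      rw [hω] at hv
      rw [h2]
      simp only [one_pow, Finset.sum_const, Finset.card_range, nsmul_eq_mul, mul_one, Nat.cast_inj]
      refine Eq.trans ?_ (card_units_pow_eq hd v)
      rw [← Fintype.card_subtype]
      refine Fintype.card_congr ⟨fun y => ⟨Units.mk0 y.1 ?_, ?_⟩, fun b => ⟨b.1, ?_⟩, fun _ => rfl,
        fun b => Subtype.ext (Units.ext rfl)⟩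
      · intro h
        have := y.2
        rw [h, zero_pow hd0] at this
        exact hu this.symm
      · ext
        rw [hv]
        simp [y.2]
      · rw [← Units.val_pow_eq_pow_val, ← b.2, hv]
    · have h3 : ∑ i ∈ Finset.range d, ω (u : F) ^ i = 0 := by
        refine (mul_eq_zero.mp ?_).resolve_right (sub_ne_zero.mpr h2)
        rw [geom_sum_mul, ← MulChar.pow_apply_coe, hωd, MulChar.one_apply_coe, sub_self]
      rw [h3, Nat.cast_eq_zero, Fintype.card_eq_zero_iff]
      refine ⟨fun y => h2 ?_⟩
      have hy0 : (y.1 : F) ≠ 0 := by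
        intro h
        have := y.2
        rw [h, zero_pow hd0] at this
        exact hu this.symm
      rw [← y.2, map_pow, ← MulChar.pow_apply' _ hd0, hωd,
        MulChar.one_apply (isUnit_iff_ne_zero.mpr hy0)]

theorem card_filter_sum_eq_zero {d s : ℕ} [NeZero d] :
    (Finset.univ.filter fun i : Fin (s + 1) → ZMod d => ∑ j, i j = 0).card = d ^ s := by
  have h1 : (Finset.univ : Finset (Fin s → ZMod d)).card = d ^ s := by
    simp [Finset.card_univ, ZMod.card]
  refine Eq.trans (Finset.card_nbij' (t := Finset.univ) Fin.tail
    (fun v : Fin s → ZMod d => (Fin.cons (- ∑ j, v j) v : Fin (s + 1) → ZMod d))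
    (fun _ _ => Finset.mem_coe.mpr (Finset.mem_univ _)) (fun v _ => ?_) (fun i hi => ?_)
    fun v _ => ?_) h1
  · simp [Fin.sum_univ_succ]
  · have hi := (Finset.mem_filter.mp hi).2
    rw [Fin.sum_univ_succ] at hi
    have h2 : - ∑ j, Fin.tail i j = i 0 := (eq_neg_of_add_eq_zero_left hi).symm
    simp only [h2, Fin.cons_self_tail]
  · exact Fin.tail_cons _ _

theorem sum_card_filter_ne_zero {d s : ℕ} [NeZero d] :
    ∑ i : Fin (s + 1) → ZMod d, (Finset.univ.filter fun j => i j ≠ 0).card =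
      (s + 1) * ((d - 1) * d ^ s) := by
  have h1 : ∀ j : Fin (s + 1), ∑ i : Fin (s + 1) → ZMod d, (if i j ≠ 0 then 1 else 0) =
      (d - 1) * d ^ s := by
    intro j
    have h2 : ∀ i : Fin (s + 1) → ZMod d, (if i j ≠ 0 then 1 else 0) =
        ∏ l, (if l = j → i l ≠ 0 then 1 else 0) := by
      intro i
      rw [← Finset.mul_prod_erase _ _ (Finset.mem_univ j), Finset.prod_eq_one, mul_one]
      · simp
      · intro l hl
        exact if_pos fun h => absurd h (Finset.ne_of_mem_erase hl)
    simp_rw [h2]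
    rw [← Fintype.prod_sum (fun l (a : ZMod d) => if l = j → a ≠ 0 then 1 else 0),
      ← Finset.mul_prod_erase _ _ (Finset.mem_univ j)]
    congr 1
    · simp only [forall_const, ← Finset.card_filter]
      rw [Finset.filter_ne', Finset.card_erase_of_mem (Finset.mem_univ _), Finset.card_univ,
        ZMod.card]
    · rw [Finset.prod_congr rfl (g := fun _ => d)]
      · simp
      · intro l hl
        have := Finset.ne_of_mem_erase hl
        simp [this, ZMod.card]
  simp_rw [Finset.card_filter]
  rw [Finset.sum_comm, Finset.sum_congr rfl fun j _ => h1 j]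
  simp

theorem norm_sum_prod_extPow_le {F : Type*} [Field F] [Fintype F] {r d : ℕ} [NeZero d]
    (hd : d ∣ Fintype.card F - 1) {ω : MulChar F ℂ} (hω : orderOf ω = d) {c : Fin r → F}
    (hc : Function.Injective c) {i : Fin r → ZMod d} (hi : i ≠ 0) :
    ‖∑ x, ∏ j, extPow ω (i j) (x + c j) + (if ∑ j, i j = 0 then 1 else 0)‖ ≤
      (((Finset.univ.filter fun j => i j ≠ 0).card : ℝ) - 1 - (if ∑ j, i j = 0 then 1 else 0)) *
        √(Fintype.card F) := by
  obtain ⟨j₀, hj₀⟩ := Function.ne_iff.mp hi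
  have hωd : ω ^ d = 1 := hω ▸ pow_orderOf_eq_one ω
  let κ := {j : Fin r // i j ≠ 0}
  have hcard : (Finset.univ.filter fun j => i j ≠ 0).card = Fintype.card κ :=
    (Fintype.card_subtype _).symm
  have hprod : ∀ x, ∏ j, extPow ω (i j) (x + c j) = ∏ j : κ, (ω ^ (i j).val) (x + c j) := by
    intro x
    rw [← Finset.prod_filter_mul_prod_filter_not _ fun j => i j ≠ 0,
      Finset.prod_eq_one (s := Finset.univ.filter fun j => ¬ i j ≠ 0), mul_one,
      Finset.prod_subtype (p := fun j => i j ≠ 0) _ (by simp)]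
    · exact Finset.prod_congr rfl fun j _ => by rw [extPow, if_neg j.2]
    · intro j hj
      rw [extPow, if_pos (not_not.mp (Finset.mem_filter.mp hj).2)]
  have hone : ∑ j, i j = 0 → ∏ j : κ, ω ^ (i j).val = 1 := by
    intro h
    rw [Finset.prod_pow_eq_pow_sum, ← orderOf_dvd_iff_pow_eq_one, hω, ← ZMod.natCast_eq_zero_iff,
      Nat.cast_sum]
    simp only [ZMod.natCast_zmod_val]
    refine Eq.trans ?_ ((Finset.sum_filter_ne_zero _).trans h)
    exact (Finset.sum_subtype (p := fun j => i j ≠ 0) (Finset.univ.filter fun j => i j ≠ 0)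
      (fun j => by simp) i).symm
  have hmain := norm_sum_prod_mulChar_le hd (c := fun j : κ => c j)
    (hc.comp Subtype.val_injective) (χ := fun j : κ => ω ^ (i j).val)
    (fun j => by rw [← pow_mul, mul_comm, pow_mul, hωd, one_pow])
    ⟨⟨j₀, hj₀⟩, fun h => by
      have := Nat.le_of_dvd ?_ (hω ▸ orderOf_dvd_of_pow_eq_one h)
      · exact absurd (ZMod.val_lt (i j₀)) (not_lt.mpr this)
      · exact Nat.pos_of_ne_zero ((ZMod.val_ne_zero _).mpr hj₀)⟩
  simp_rw [hprod, hcard]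
  split_ifs with h
  · rw [sub_sub, one_add_one_eq_two]
    exact hmain.2 (hone h)
  · rw [add_zero, sub_zero]
    exact hmain.1

theorem abs_card_system_sub_le {F : Type*} [Field F] [Fintype F] {r d : ℕ}
    (hd : d ∣ Fintype.card F - 1) (hr : 0 < r) {c : Fin r → F} (hc : Function.Injective c) :
    |(Nat.card {v : F × (Fin r → F) // ∀ j : Fin r, v.2 j ^ d = v.1 + c j} : ℝ) +
        (d : ℝ) ^ (r - 1) - Fintype.card F - 1| ≤
      (((r : ℝ) * d - r - d - 1) * (d : ℝ) ^ (r - 1) + 2) * √(Fintype.card F) := by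
  classical
  have hq1 : 1 < Fintype.card F := Fintype.one_lt_card
  have : NeZero d := ⟨by
    rintro rfl
    rw [zero_dvd_iff] at hd
    omega⟩
  obtain ⟨s, rfl⟩ := Nat.exists_eq_succ_of_ne_zero hr.ne'
  obtain ⟨ω, hω⟩ := MulChar.exists_mulChar_orderOf F hd
    (Complex.isPrimitiveRoot_exp d (NeZero.ne d))
  set q := Fintype.card F with hq
  set N := Nat.card {v : F × (Fin (s + 1) → F) // ∀ j, v.2 j ^ d = v.1 + c j} with hN
  have hN1 : (N : ℂ) = ∑ i : Fin (s + 1) → ZMod d, ∑ x, ∏ j, extPow ω (i j) (x + c j) := by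
    have e : {v : F × (Fin (s + 1) → F) // ∀ j, v.2 j ^ d = v.1 + c j} ≃
        (Σ x : F, ∀ j, {y : F // y ^ d = x + c j}) :=
      ⟨fun v => ⟨v.1.1, fun j => ⟨v.1.2 j, v.2 j⟩⟩, fun w => ⟨(w.1, fun j => (w.2 j).1),
        fun j => (w.2 j).2⟩, fun _ => rfl, fun _ => rfl⟩
    rw [hN, Nat.card_congr e, Nat.card_eq_fintype_card, Fintype.card_sigma, Finset.sum_comm]
    push_cast
    refine Finset.sum_congr rfl fun x _ => ?_
    rw [Fintype.card_pi, ← Fintype.prod_sum (fun j (a : ZMod d) => extPow ω a (x + c j))]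
    push_cast
    exact Finset.prod_congr rfl fun j _ => card_pow_eq_sum_extPow hd hω _
  let T : (Fin (s + 1) → ZMod d) → ℂ := fun i =>
    ∑ x, ∏ j, extPow ω (i j) (x + c j) + (if ∑ j, i j = 0 then 1 else 0)
  let m : (Fin (s + 1) → ZMod d) → ℝ := fun i =>
    ((Finset.univ.filter fun j => i j ≠ 0).card : ℝ) - 1 - (if ∑ j, i j = 0 then 1 else 0)
  have hT : ∑ i, T i = N + (d : ℂ) ^ s := by
    rw [Finset.sum_add_distrib, ← hN1, Finset.sum_boole, card_filter_sum_eq_zero, Nat.cast_pow]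
  have hm : ∑ i, m i = (s + 1) * ((d - 1) * (d : ℝ) ^ s) - d ^ (s + 1) - d ^ s := by
    rw [Finset.sum_sub_distrib, Finset.sum_sub_distrib, Finset.sum_boole, card_filter_sum_eq_zero,
      ← Nat.cast_sum, sum_card_filter_ne_zero]
    have : 1 ≤ d := NeZero.one_le
    simp [ZMod.card, Nat.cast_sub this]
  have hT0 : T 0 = q + 1 := by simp [T, extPow, hq]
  have hm0 : m 0 = -2 := by
    simp [m]
    norm_num
  have h1 : ∑ i ∈ Finset.univ.erase 0, T i = ((N + (d : ℝ) ^ s - q - 1 : ℝ) : ℂ) := by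
    rw [← Finset.add_sum_erase _ _ (Finset.mem_univ 0), hT0] at hT
    push_cast
    linear_combination hT
  have h2 : ∑ i ∈ Finset.univ.erase 0, m i =
      (s + 1) * ((d - 1) * (d : ℝ) ^ s) - d ^ (s + 1) - d ^ s + 2 := by
    rw [← Finset.add_sum_erase _ _ (Finset.mem_univ 0), hm0] at hm
    linarith
  have h3 : ‖∑ i ∈ Finset.univ.erase 0, T i‖ ≤ ∑ i ∈ Finset.univ.erase 0, m i * √q :=
    norm_sum_le_of_le _ fun i hi => norm_sum_prod_extPow_le hd hω hc (Finset.ne_of_mem_erase hi)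
  rw [h1, Complex.norm_real, Real.norm_eq_abs, ← Finset.sum_mul, h2] at h3
  refine h3.trans_eq ?_
  push_cast
  ring

theorem system_solution_bound (p q : ℕ) (hp : p.Prime) (k : ℕ) (hk : 0 < k) (hq : q = p ^ k)
    (F : Type*) [Field F] [Fintype F] [CharP F p] (hcard : Fintype.card F = q)
    (d : ℕ) (hd : d ∣ q - 1) (r : ℕ) (hr : 0 < r) (hrp : r ≤ p)
    (N : ℕ)
    (hN : N = Nat.card {v : F × (Fin r → F) // ∀ j : Fin r, (v.2 j) ^ d = v.1 + (j : ℕ)}) :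
    |(N : ℝ) + (d : ℝ) ^ (r - 1) - q - 1| ≤
      (((r : ℝ) * d - r - d - 1) * (d : ℝ) ^ (r - 1) + 2) * Real.sqrt q := by
  subst hcard hN
  refine abs_card_system_sub_le hd hr (c := fun j => ((j : ℕ) : F)) fun a b hab => ?_
  exact Fin.ext (CharP.natCast_injOn_Iio F p (a.2.trans_le hrp) (b.2.trans_le hrp) hab)
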